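/- Let d ≥ 1, q ≥ 0 and 1 ≤ t ≤ 2^q be integers, let m = 2^{q+1} − t, and suppose n ≥ d + (7·2^q − 2t) + 1. Let F be a family of nonempty subsets of {1, …, n+1} admitting a coloring c : F → {1,…,m} such that no 8 pairwise disjoint members of F receive the same color. Then for every continuous map f : Δ_n → ℝ^d there exist 4 pairs (S_1, T_1), …, (S_4, T_4) of disjoint subsets of {1,…,n+1} such that f(σ_{S_i}) ∩ f(σ_{T_i}) ≠ ∅ for each i (i.e., each pair is a Radon pair for f), and such that for every choice of three indices 1 ≤ i_1 < i_2 < i_3 ≤ 4 and every choice of one set from each pair (A_{i_j} ∈ {S_{i_j}, T_{i_j}} for j = 1,2,3), the intersection A_{i_1} ∩ A_{i_2} ∩ A_{i_3} contains no member of F. -/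

import Mathlib

noncomputable section

/-- The face of the standard simplex `Δ_n ⊆ ℝ^{n+1}` spanned by the vertices in `S`. -/
def simplexFace {n : ℕ} (S : Finset (Fin (n + 1))) : Set (Fin (n + 1) → ℝ) :=
  {x ∈ stdSimplex ℝ (Fin (n + 1)) | ∀ i ∉ S, x i = 0}

open Function
set_option linter.unusedSectionVars false

namespace Radon18

/-- Mod-two boundary-type operator on functions on the lattice. -/
def Bop {ι : Type} [Fintype ι] [DecidableEq ι] (h : (ι → ℤ) → ZMod 2) (y : ι → ℤ) : ZMod 2 :=
  ∑ p, if Odd (y p) then h (update y p (y p - 1)) + h (update y p (y p + 1)) else 0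

/-- Twisted operator associated with a labelling `φ`. -/
def Aop {ι : Type} [Fintype ι] [DecidableEq ι] (φ h : (ι → ℤ) → ZMod 2) (y : ι → ℤ) : ZMod 2 :=
  Bop (fun x => φ x * h x) y + φ y * Bop h y

section basic
variable {ι : Type} [Fintype ι] [DecidableEq ι]

lemma zmod2_add_self (a : ZMod 2) : a + a = 0 := by
  revert a; decide

lemma Bop_add (h k : (ι → ℤ) → ZMod 2) (y : ι → ℤ) :
    Bop (fun x => h x + k x) y = Bop h y + Bop k y := by
  unfold Bop
  rw [← Finset.sum_add_distrib]
  refine Finset.sum_congr rfl fun p _ => ?_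
  split_ifs <;> ring

lemma Bop_const_mul (a : ZMod 2) (h : (ι → ℤ) → ZMod 2) (y : ι → ℤ) :
    Bop (fun x => a * h x) y = a * Bop h y := by
  unfold Bop
  rw [Finset.mul_sum]
  refine Finset.sum_congr rfl fun p _ => ?_
  split_ifs <;> ring

lemma Bop_one (y : ι → ℤ) : Bop (fun _ => 1) y = 0 := by
  unfold Bop
  refine Finset.sum_eq_zero fun p _ => ?_
  split_ifs
  · exact zmod2_add_self 1
  · rfl

lemma sum_sum_symm_zero {α : Type} [Fintype α] [DecidableEq α] (T : α → α → ZMod 2)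
    (hs : ∀ i j, T i j = T j i) (hd : ∀ i, T i i = 0) : ∑ i, ∑ j, T i j = 0 := by
  rw [← Finset.sum_product']
  refine Finset.sum_involution (fun x _ => (x.2, x.1)) ?_ ?_ ?_ ?_
  · intro x _
    show T x.1 x.2 + T x.2 x.1 = 0
    rw [hs x.2 x.1]; exact zmod2_add_self _
  · intro x _ hx he
    apply hx
    have : x.2 = x.1 := congrArg Prod.fst he
    show T x.1 x.2 = 0
    rw [this]; exact hd _
  · intros; simp
  · intros; rfl

lemma Bop_Bop (h : (ι → ℤ) → ZMod 2) (y : ι → ℤ) : Bop (Bop h) y = 0 := by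
  have key : Bop (Bop h) y = ∑ p, ∑ q, (if p = q then 0 else
      if Odd (y p) then if Odd (y q) then
        (h (update (update y p (y p - 1)) q (y q - 1)) + h (update (update y p (y p - 1)) q (y q + 1)))
        + (h (update (update y p (y p + 1)) q (y q - 1)) + h (update (update y p (y p + 1)) q (y q + 1)))
        else 0 else 0) := by
    conv_lhs => unfold Bop
    refine Finset.sum_congr rfl fun p _ => ?_
    by_cases hp : Odd (y p)
    · rw [if_pos hp]
      rw [← Finset.sum_add_distrib]
      refine Finset.sum_congr rfl fun q _ => ?_
      by_cases hpq : p = q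
      · subst hpq
        have h1 : ¬ Odd (y p - 1) := by
          rw [Int.not_odd_iff_even]; exact hp.sub_odd odd_one
        have h2 : ¬ Odd (y p + 1) := by
          rw [Int.not_odd_iff_even]; exact hp.add_odd odd_one
        simp [h1, h2]
      · have hqp : q ≠ p := fun e => hpq e.symm
        simp only [update_of_ne hqp, hpq, if_false, hp, if_true]
        split_ifs <;> simp
    · rw [if_neg hp]
      symm
      refine Finset.sum_eq_zero fun q _ => ?_
      simp [hp]
  rw [key]
  refine sum_sum_symm_zero _ ?_ ?_
  · intro p q
    by_cases hpq : p = q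
    · subst hpq; rfl
    · have hqp : q ≠ p := fun e => hpq e.symm
      simp only [hpq, hqp, if_false]
      by_cases hp : Odd (y p) <;> by_cases hq : Odd (y q) <;> simp only [hp, hq, if_true, if_false]
      rw [update_comm hqp, update_comm hqp, update_comm hqp, update_comm hqp]
      ring
  · intro p; simp

lemma Aop_eq (φ h : (ι → ℤ) → ZMod 2) (y : ι → ℤ) :
    Aop φ h y = ∑ p, if Odd (y p) then
      (φ (update y p (y p - 1)) + φ y) * h (update y p (y p - 1)) +
      (φ (update y p (y p + 1)) + φ y) * h (update y p (y p + 1)) else 0 := by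
  unfold Aop Bop
  rw [Finset.mul_sum, ← Finset.sum_add_distrib]
  refine Finset.sum_congr rfl fun p _ => ?_
  split_ifs <;> ring

lemma Bop_zero (y : ι → ℤ) : Bop (fun _ => 0) y = 0 := by
  unfold Bop; simp

lemma Bop_Aop (φ h : (ι → ℤ) → ZMod 2) (y : ι → ℤ) : Bop (Aop φ h) y = Aop φ (Bop h) y := by
  have : Aop φ h = fun y => Bop (fun x => φ x * h x) y + φ y * Bop h y := rfl
  rw [this, Bop_add]
  unfold Aop
  have h1 := Bop_Bop (fun x => φ x * h x) y
  have h2 := Bop_Bop h y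
  change Bop (fun y => Bop (fun x => φ x * h x) y) y = 0 at h1
  rw [h1, h2]; ring

/-- Iterated twisted operators. -/
def Wop (l : List ((ι → ℤ) → ZMod 2)) (h : (ι → ℤ) → ZMod 2) : (ι → ℤ) → ZMod 2 :=
  l.foldr Aop h

lemma Wop_cons (φ) (l : List ((ι → ℤ) → ZMod 2)) (h : (ι → ℤ) → ZMod 2) :
    Wop (φ :: l) h = Aop φ (Wop l h) := rfl

lemma Wop_append (l l' : List ((ι → ℤ) → ZMod 2)) (h : (ι → ℤ) → ZMod 2) :
    Wop (l ++ l') h = Wop l (Wop l' h) := by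
  simp [Wop]

lemma Bop_Wop (l : List ((ι → ℤ) → ZMod 2)) (h : (ι → ℤ) → ZMod 2) :
    Bop (Wop l h) = Wop l (Bop h) := by
  induction l with
  | nil => rfl
  | cons φ l ih =>
    funext y
    rw [Wop_cons, Bop_Aop, ih, Wop_cons]

lemma Aop_zero (φ : (ι → ℤ) → ZMod 2) : Aop φ (fun _ => 0) = fun _ => 0 := by
  funext y; rw [Aop_eq]; simp

lemma Wop_zero (l : List ((ι → ℤ) → ZMod 2)) : Wop l (fun _ => 0) = fun _ => 0 := by
  induction l with
  | nil => rfl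
  | cons φ l ih => rw [Wop_cons, ih, Aop_zero]

lemma Bop_Wop_one (l : List ((ι → ℤ) → ZMod 2)) : Bop (Wop l (fun _ => 1)) = fun _ => 0 := by
  rw [Bop_Wop]
  have : Bop (fun _ : ι → ℤ => (1 : ZMod 2)) = fun _ => 0 := by
    funext y; exact Bop_one y
  rw [this, Wop_zero]

/-- Key formula: an operator twisted by `ψ` in the middle of a word becomes a `Bop`-image. -/
lemma Wop_middle (l l' : List ((ι → ℤ) → ZMod 2)) (ψ : (ι → ℤ) → ZMod 2) :
    Wop (l ++ ψ :: l') (fun _ => 1) = Bop (Wop l (fun x => ψ x * Wop l' (fun _ => 1) x)) := by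
  rw [Bop_Wop, Wop_append, Wop_cons]
  congr 1
  funext y
  unfold Aop
  rw [Bop_Wop_one]; simp

/-- Number of odd coordinates. -/
def oddc (y : ι → ℤ) : ℕ := (Finset.univ.filter fun p => Odd (y p)).card

lemma oddc_update {y : ι → ℤ} {p : ι} (hp : Odd (y p)) {z : ℤ} (hz : Even z) :
    oddc y = oddc (update y p z) + 1 := by
  unfold oddc
  rw [← Finset.card_erase_add_one (s := Finset.univ.filter fun p => Odd (y p)) (a := p) (by simp [hp])]
  congr 2
  ext q
  by_cases hq : q = p
  · subst hq; simpa using hz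
  · simp [hq]

lemma Bop_supp {h : (ι → ℤ) → ZMod 2} {r : ℕ} (hh : ∀ y, h y ≠ 0 → r ≤ oddc y) (y : ι → ℤ)
    (hy : Bop h y ≠ 0) : r + 1 ≤ oddc y := by
  unfold Bop at hy
  obtain ⟨p, -, hp⟩ := Finset.exists_ne_zero_of_sum_ne_zero hy
  by_cases ho : Odd (y p)
  · rw [if_pos ho] at hp
    by_cases h1 : h (update y p (y p - 1)) = 0
    · have h2 : h (update y p (y p + 1)) ≠ 0 := by
        intro h2; apply hp; rw [h1, h2]; simp
      have := hh _ h2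
      rw [oddc_update ho (ho.add_odd odd_one)]; omega
    · have := hh _ h1
      rw [oddc_update ho (ho.sub_odd odd_one)]; omega
  · simp [ho] at hp

lemma Aop_supp {φ h : (ι → ℤ) → ZMod 2} {r : ℕ} (hh : ∀ y, h y ≠ 0 → r ≤ oddc y) (y : ι → ℤ)
    (hy : Aop φ h y ≠ 0) : r + 1 ≤ oddc y := by
  unfold Aop at hy
  by_cases h1 : Bop (fun x => φ x * h x) y = 0
  · rw [h1, zero_add] at hy
    exact Bop_supp hh y (right_ne_zero_of_mul hy)
  · exact Bop_supp (h := fun x => φ x * h x) (fun z hz => hh z (right_ne_zero_of_mul hz)) y h1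

lemma Wop_supp (l : List ((ι → ℤ) → ZMod 2)) {h : (ι → ℤ) → ZMod 2} {r : ℕ}
    (hh : ∀ y, h y ≠ 0 → r ≤ oddc y) (y : ι → ℤ)
    (hy : Wop l h y ≠ 0) : r + l.length ≤ oddc y := by
  induction l generalizing y with
  | nil => exact hh y hy
  | cons φ l ih =>
    rw [Wop_cons] at hy
    have := Aop_supp ih y hy
    simpa [add_assoc] using this

/-- Steps in a nonvanishing word. -/
lemma Aop_step {φ h : (ι → ℤ) → ZMod 2} {y : ι → ℤ} (hy : Aop φ h y ≠ 0) :
    ∃ p z, Odd (y p) ∧ |z - y p| = 1 ∧ φ (update y p z) ≠ φ y ∧ h (update y p z) ≠ 0 := by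
  rw [Aop_eq] at hy
  obtain ⟨p, -, hp⟩ := Finset.exists_ne_zero_of_sum_ne_zero hy
  by_cases ho : Odd (y p)
  · rw [if_pos ho] at hp
    have aux : ∀ a b c : ZMod 2, (a + b) * c ≠ 0 → a ≠ b ∧ c ≠ 0 := by decide
    by_cases h1 : (φ (update y p (y p - 1)) + φ y) * h (update y p (y p - 1)) = 0
    · have h2 : (φ (update y p (y p + 1)) + φ y) * h (update y p (y p + 1)) ≠ 0 := by
        intro h2; apply hp; rw [h1, h2]; simp
      exact ⟨p, y p + 1, ho, by simp, (aux _ _ _ h2).1, (aux _ _ _ h2).2⟩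
    · exact ⟨p, y p - 1, ho, by simp, (aux _ _ _ h1).1, (aux _ _ _ h1).2⟩
  · simp [ho] at hp

end basic
end Radon18

namespace Radon18

/-- The sign `±1` attached to an element of `ZMod 2`. -/
def sg (e : ZMod 2) : ℤ := if e = 0 then 1 else -1

lemma sg_mul_self (e : ZMod 2) : sg e * sg e = 1 := by revert e; decide
lemma sg_add (e f : ZMod 2) : sg (e + f) = sg e * sg f := by revert e f; decide
lemma sg_cases (e : ZMod 2) : sg e = 1 ∨ sg e = -1 := by revert e; decide
lemma abs_sg (e : ZMod 2) : |sg e| = 1 := by revert e; decide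

section sphere
variable {β : Type} [Fintype β] [DecidableEq β] {n : ℕ}

/-- Sign changes in blocks. -/
def act (g : β → ZMod 2) (y : β × Fin (n + 1) → ℤ) : β × Fin (n + 1) → ℤ :=
  fun p => sg (g p.1) * y p

lemma act_act (g : β → ZMod 2) (y : β × Fin (n + 1) → ℤ) : act g (act g y) = y := by
  funext p
  simp only [act]
  rw [← mul_assoc, sg_mul_self, one_mul]

lemma act_update (g : β → ZMod 2) (y : β × Fin (n + 1) → ℤ) (p) (z : ℤ) :
    act g (update y p z) = update (act g y) p (sg (g p.1) * z) := by
  funext q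
  by_cases h : q = p
  · subst h; simp [act]
  · simp [act, h]

lemma odd_sg_mul (e : ZMod 2) (z : ℤ) : Odd (sg e * z) ↔ Odd z := by
  rcases sg_cases e with h | h <;> rw [h] <;> simp

lemma Bop_act (h : (β × Fin (n + 1) → ℤ) → ZMod 2) (g : β → ZMod 2) (y : β × Fin (n + 1) → ℤ) :
    Bop h (act g y) = Bop (fun x => h (act g x)) y := by
  unfold Bop
  refine Finset.sum_congr rfl fun p _ => ?_
  have : act g y p = sg (g p.1) * y p := rfl
  simp only [this, odd_sg_mul, act_update]
  by_cases ho : Odd (y p)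
  · simp only [ho, if_true]
    rcases sg_cases (g p.1) with hs | hs <;> rw [hs]
    · simp only [one_mul]
    · rw [add_comm]
      congr 3 <;> ring
  · simp [ho]

/-- The lattice points of the product of the boundaries of the cubes `[-L, L]^(n+1)`. -/
def inP (L : ℤ) (y : β × Fin (n + 1) → ℤ) : Prop :=
  (∀ p, |y p| ≤ L) ∧ ∀ i, ∃ q, |y (i, q)| = L

open Classical in
/-- `inP` as a finite set. -/
def PP (β : Type) [Fintype β] [DecidableEq β] (n : ℕ) (L : ℤ) : Finset (β × Fin (n + 1) → ℤ) :=
  (Fintype.piFinset fun _ => Finset.Icc (-L) L).filter (inP L)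

lemma mem_PP {L : ℤ} {y : β × Fin (n + 1) → ℤ} : y ∈ PP β n L ↔ inP L y := by
  classical
  unfold PP
  simp only [Finset.mem_filter, Fintype.mem_piFinset, Finset.mem_Icc, and_iff_right_iff_imp]
  intro h p
  exact abs_le.mp (h.1 p)

lemma inP_act {L : ℤ} {y : β × Fin (n + 1) → ℤ} (g : β → ZMod 2) (h : inP L y) :
    inP L (act g y) := by
  constructor
  · intro p; simp only [act, abs_mul, abs_sg, one_mul]; exact h.1 p
  · intro i
    obtain ⟨q, hq⟩ := h.2 i
    exact ⟨q, by simp only [act, abs_mul, abs_sg, one_mul]; exact hq⟩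

lemma abs_even {z : ℤ} : Even |z| ↔ Even z := even_abs

lemma inP_down {L : ℤ} (hL : Even L) {y : β × Fin (n + 1) → ℤ} (h : inP L y)
    {p : β × Fin (n + 1)} (ho : Odd (y p)) {z : ℤ} (hz : |z - y p| = 1) : inP L (update y p z) := by
  have hne : |y p| ≠ L := by
    intro e
    rw [← e, even_abs] at hL
    exact (Int.not_even_iff_odd.mpr ho) hL
  constructor
  · intro q
    by_cases hq : q = p
    · subst hq
      rw [update_self]
      have h1 := h.1 q
      have h2 : |z| ≤ |z - y q| + |y q| := by
        have := abs_add_le (z - y q) (y q); simpa using this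
      have : |y q| < L := lt_of_le_of_ne h1 hne
      omega
    · rw [update_of_ne hq]; exact h.1 q
  · intro i
    obtain ⟨q, hq⟩ := h.2 i
    refine ⟨q, ?_⟩
    rw [update_of_ne]
    · exact hq
    · rintro rfl; exact hne hq

lemma Bop_congr {L : ℤ} (hL : Even L) {h k : (β × Fin (n + 1) → ℤ) → ZMod 2}
    (hk : ∀ y, inP L y → h y = k y) {y} (hy : inP L y) : Bop h y = Bop k y := by
  unfold Bop
  refine Finset.sum_congr rfl fun p _ => ?_
  by_cases ho : Odd (y p)
  · simp only [ho, if_true]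
    rw [hk _ (inP_down hL hy ho (by simp)), hk _ (inP_down hL hy ho (by simp))]
  · simp [ho]

/-- Invariance on the sphere product. -/
def Inv (L : ℤ) (h : (β × Fin (n + 1) → ℤ) → ZMod 2) : Prop :=
  ∀ g y, inP L y → h (act g y) = h y

/-- Equivariance with respect to the character `a`. -/
def Twist (L : ℤ) (a : β → ZMod 2) (φ : (β × Fin (n + 1) → ℤ) → ZMod 2) : Prop :=
  ∀ g y, inP L y → φ (act g y) = φ y + ∑ i, a i * g i

lemma Inv.Bop {L : ℤ} (hL : Even L) {h : (β × Fin (n + 1) → ℤ) → ZMod 2} (hh : Inv L h) :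
    Inv L (Bop h) := by
  intro g y hy
  rw [Bop_act]
  exact Bop_congr hL (fun x hx => hh g x hx) hy

lemma Inv.Aop {L : ℤ} (hL : Even L) {h φ : (β × Fin (n + 1) → ℤ) → ZMod 2} {a} (hφ : Twist L a φ)
    (hh : Inv L h) : Inv L (Aop φ h) := by
  intro g y hy
  unfold Radon18.Aop
  rw [Bop_act, Bop_act, hφ g y hy]
  rw [Bop_congr hL (fun x hx => hh g x hx) hy]
  have : Radon18.Bop (fun x => φ (act g x) * h (act g x)) y =
      Radon18.Bop (fun x => φ x * h x + (∑ i, a i * g i) * h x) y := by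
    refine Bop_congr hL (fun x hx => ?_) hy
    rw [hφ g x hx, hh g x hx]; ring
  rw [this, Bop_add, Bop_const_mul]
  have := zmod2_add_self ((∑ i, a i * g i) * Radon18.Bop h y)
  linear_combination this

lemma Inv.Wop {L : ℤ} (hL : Even L) {l : List ((β × Fin (n + 1) → ℤ) → ZMod 2)}
    (hl : ∀ φ ∈ l, ∃ a, Twist L a φ) {h : (β × Fin (n + 1) → ℤ) → ZMod 2}
    (hh : Inv L h) : Inv L (Wop l h) := by
  induction l with
  | nil => exact hh
  | cons φ l ih =>
    obtain ⟨a, ha⟩ := hl φ (by simp)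
    rw [Wop_cons]
    exact Inv.Aop hL ha (ih fun ψ hψ => hl ψ (by simp [hψ]))

/-- The sign label of the first nonzero coordinate. -/
def eps (b : Fin (n + 1) → ℤ) : ZMod 2 :=
  open Classical in if ∃ p, (∀ q < p, b q = 0) ∧ b p < 0 then 1 else 0

lemma exists_first {b : Fin (n + 1) → ℤ} (hb : ∃ q, b q ≠ 0) :
    ∃ p, (∀ q < p, b q = 0) ∧ b p ≠ 0 := by
  classical
  obtain ⟨p, hp, hm⟩ := (Set.toFinite {q | b q ≠ 0}).exists_minimal hb
  refine ⟨p, fun q hq => ?_, hp⟩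
  by_contra h
  exact absurd (hm h hq.le) (not_le.mpr hq)

lemma eps_of_first {b : Fin (n + 1) → ℤ} {p} (h0 : ∀ q < p, b q = 0) (hp : b p ≠ 0) :
    eps b = if b p < 0 then 1 else 0 := by
  unfold eps
  congr 1
  apply propext
  constructor
  · rintro ⟨q, hq, hq'⟩
    rcases lt_trichotomy q p with h | h | h
    · rw [h0 q h] at hq'; omega
    · subst h; exact hq'
    · exact absurd (hq p h) hp
  · intro h; exact ⟨p, h0, h⟩

lemma eps_sg {b : Fin (n + 1) → ℤ} (hb : ∃ q, b q ≠ 0) (e : ZMod 2) :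
    eps (fun q => sg e * b q) = eps b + e := by
  obtain ⟨p, h0, hp⟩ := exists_first hb
  rw [eps_of_first h0 hp, eps_of_first (p := p) (fun q hq => by simp [h0 q hq])]
  · have : e = 0 ∨ e = 1 := by revert e; decide
    rcases this with rfl | rfl
    · simp [sg]
    · have h1 : sg 1 = -1 := by decide
      rw [h1]
      rcases lt_or_gt_of_ne hp with h | h
      · have : ¬ (-1 * b p < 0) := by omega
        rw [if_neg this, if_pos h]; decide
      · have : (-1 * b p < 0) := by omega
        rw [if_pos this, if_neg (by omega)]; decide
  · rcases sg_cases e with h | h <;> rw [h] <;> simpa using hp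

/-- Block of a point. -/
def blk (y : β × Fin (n + 1) → ℤ) (i : β) : Fin (n + 1) → ℤ := fun q => y (i, q)

lemma blk_act (g : β → ZMod 2) (y : β × Fin (n + 1) → ℤ) (i : β) :
    blk (act g y) i = fun q => sg (g i) * blk y i q := rfl

lemma blk_ne {L : ℤ} (hL : 0 < L) {y : β × Fin (n + 1) → ℤ} (hy : inP L y) (i : β) :
    ∃ q, blk y i q ≠ 0 := by
  obtain ⟨q, hq⟩ := hy.2 i
  refine ⟨q, fun h => ?_⟩
  change y (i, q) = 0 at h
  rw [h, abs_zero] at hq; omega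

/-- Fundamental domain weight. -/
def kap (y : β × Fin (n + 1) → ℤ) : ZMod 2 := ∏ i, (1 + eps (blk y i))

lemma sum_kap {L : ℤ} (hL : 0 < L) {y : β × Fin (n + 1) → ℤ} (hy : inP L y) :
    ∑ g : β → ZMod 2, kap (act g y) = 1 := by
  unfold kap
  have h1 : ∀ g : β → ZMod 2, ∏ i, (1 + eps (blk (act g y) i)) =
      ∏ i, (fun i (e : ZMod 2) => 1 + (eps (blk y i) + e)) i (g i) := by
    intro g
    refine Finset.prod_congr rfl fun i _ => ?_
    rw [blk_act, eps_sg (blk_ne hL hy i)]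
  rw [Finset.sum_congr rfl (fun g _ => h1 g)]
  have h2 := (Finset.prod_univ_sum (fun _ : β => (Finset.univ : Finset (ZMod 2)))
    (fun i e => 1 + (eps (blk y i) + e))).symm
  rw [Fintype.piFinset_univ] at h2
  rw [h2]
  refine Finset.prod_eq_one fun i _ => ?_
  generalize eps (blk y i) = e
  revert e; decide

/-- Integration over the fundamental cycle. -/
def integ (L : ℤ) (h : (β × Fin (n + 1) → ℤ) → ZMod 2) : ZMod 2 :=
  ∑ y ∈ PP β n L, kap y * h y

open Classical in
lemma Bop_eq_sum {L : ℤ} (hL : Even L) (h : (β × Fin (n + 1) → ℤ) → ZMod 2) {y} (hy : inP L y) :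
    Bop h y = ∑ x ∈ PP β n L, h x * Bop (fun x' => if x' = x then 1 else 0) y := by
  have : ∀ s : Finset (β × Fin (n + 1) → ℤ), ∑ x ∈ s, h x * Bop (fun x' => if x' = x then 1 else 0) y
      = Bop (fun x' => ∑ x ∈ s, h x * if x' = x then 1 else 0) y := by
    intro s
    induction s using Finset.induction_on with
    | empty => simp [Bop_zero]
    | insert a s ha ih =>
      rw [Finset.sum_insert ha, ih]
      simp_rw [Finset.sum_insert ha]
      rw [Bop_add, Bop_const_mul]
  rw [this]
  refine Bop_congr hL (fun x hx => ?_) hy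
  rw [Finset.sum_eq_single x]
  · simp
  · intro b _ hb; simp [hb.symm]
  · intro hx'; exact absurd (mem_PP.mpr hx) hx'

lemma sum_PP_act {L : ℤ} (g : β → ZMod 2) (f : (β × Fin (n + 1) → ℤ) → ZMod 2) :
    ∑ y ∈ PP β n L, f (act g y) = ∑ y ∈ PP β n L, f y := by
  refine Finset.sum_nbij' (act g) (act g) ?_ ?_ ?_ ?_ ?_
  · intro y hy; exact mem_PP.mpr (inP_act g (mem_PP.mp hy))
  · intro y hy; exact mem_PP.mpr (inP_act g (mem_PP.mp hy))
  · intro y _; exact act_act g y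
  · intro y _; exact act_act g y
  · intro y _; rfl

open Classical in
lemma integ_Bop_swap {L : ℤ} (hL : Even L) (hL0 : 0 < L) {h : (β × Fin (n + 1) → ℤ) → ZMod 2}
    (hh : Inv L h) :
    integ L (Bop h) = ∑ x ∈ PP β n L, kap x * h x *
      ∑ y ∈ PP β n L, Bop (fun x' => if x' = x then 1 else 0) y := by
  set C : (β × Fin (n + 1) → ℤ) → (β × Fin (n + 1) → ℤ) → ZMod 2 :=
    fun x y => Bop (fun x' => if x' = x then 1 else 0) y with hC
  have hCg : ∀ g x y, C (act g x) (act g y) = C x y := by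
    intro g x y
    simp only [hC]
    rw [Bop_act]
    congr 1
    funext x'
    have : act g x' = act g x ↔ x' = x := by
      constructor
      · intro e; rw [← act_act g x', e, act_act]
      · rintro rfl; rfl
    simp only [this]
  have h1 : integ L (Bop h) = ∑ y ∈ PP β n L, ∑ x ∈ PP β n L, kap y * (h x * C x y) := by
    unfold integ
    refine Finset.sum_congr rfl fun y hy => ?_
    rw [Bop_eq_sum hL h (mem_PP.mp hy), Finset.mul_sum]
  have h2 : ∑ y ∈ PP β n L, ∑ x ∈ PP β n L, kap y * (h x * C x y) =
      ∑ g : β → ZMod 2, ∑ y ∈ PP β n L, ∑ x ∈ PP β n L,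
        kap (act g x) * (kap y * (h x * C x y)) := by
    symm
    rw [Finset.sum_comm]
    refine Finset.sum_congr rfl fun y _ => ?_
    rw [Finset.sum_comm]
    refine Finset.sum_congr rfl fun x hx => ?_
    rw [← Finset.sum_mul, sum_kap hL0 (mem_PP.mp hx), one_mul]
  have h3 : ∀ g : β → ZMod 2, ∑ y ∈ PP β n L, ∑ x ∈ PP β n L,
        kap (act g x) * (kap y * (h x * C x y)) = ∑ y ∈ PP β n L, ∑ x ∈ PP β n L,
        kap x * (kap (act g y) * (h x * C x y)) := by
    intro g
    refine (sum_PP_act g _).symm.trans ?_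
    refine Finset.sum_congr rfl fun y _ => ?_
    refine (sum_PP_act g _).symm.trans ?_
    refine Finset.sum_congr rfl fun x hx => ?_
    rw [act_act, hCg, hh g x (mem_PP.mp hx)]
  rw [h1, h2]
  simp_rw [h3]
  rw [Finset.sum_comm]
  have h4 : ∀ y ∈ PP β n L, ∑ g : β → ZMod 2, ∑ x ∈ PP β n L,
      kap x * (kap (act g y) * (h x * C x y)) = ∑ x ∈ PP β n L, kap x * h x * C x y := by
    intro y hy
    rw [Finset.sum_comm]
    refine Finset.sum_congr rfl fun x _ => ?_
    have : ∀ g : β → ZMod 2, kap x * (kap (act g y) * (h x * C x y)) =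
      kap (act g y) * (kap x * h x * C x y) := fun g => by ring
    simp_rw [this]
    rw [← Finset.sum_mul, sum_kap hL0 (mem_PP.mp hy), one_mul]
  rw [Finset.sum_congr rfl h4, Finset.sum_comm]
  refine Finset.sum_congr rfl fun x _ => ?_
  rw [Finset.mul_sum]

end sphere
end Radon18

namespace Radon18
section upsum
variable {β : Type} [Fintype β] [DecidableEq β] {n : ℕ}

open Classical in
/-- Coordinates of block `i` of maximal size. -/
def Kset (L : ℤ) (x : β × Fin (n + 1) → ℤ) (i : β) : Finset (Fin (n + 1)) :=
  Finset.univ.filter fun q => |x (i, q)| = L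

open Classical in
/-- Contribution of a coordinate. -/
def tcon (L : ℤ) (x : β × Fin (n + 1) → ℤ) (p : β × Fin (n + 1)) : ZMod 2 :=
  if Even (x p) then (if inP L (update x p (x p + 1)) then 1 else 0) +
    (if inP L (update x p (x p - 1)) then 1 else 0) else 0

open Classical in
lemma upsum_eq (L : ℤ) (x : β × Fin (n + 1) → ℤ) :
    ∑ y ∈ PP β n L, Bop (fun x' => if x' = x then 1 else 0) y = ∑ p, tcon L x p := by
  unfold Bop
  rw [Finset.sum_comm]
  refine Finset.sum_congr rfl fun p _ => ?_
  have h1 : ∀ y : β × Fin (n + 1) → ℤ, (if Odd (y p) then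
      (if update y p (y p - 1) = x then (1 : ZMod 2) else 0) +
      (if update y p (y p + 1) = x then 1 else 0) else 0) =
      (if y = update x p (x p + 1) then (if Even (x p) then 1 else 0) else 0) +
      (if y = update x p (x p - 1) then (if Even (x p) then 1 else 0) else 0) := by
    intro y
    have e1 : update y p (y p - 1) = x ↔ y = update x p (x p + 1) := by
      constructor
      · rintro rfl; simp
      · intro h; rw [h]; simp
    have e2 : update y p (y p + 1) = x ↔ y = update x p (x p - 1) := by
      constructor
      · rintro rfl; simp
      · intro h; rw [h]; simp
    rw [if_congr e1 rfl rfl, if_congr e2 rfl rfl]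
    by_cases a1 : y = update x p (x p + 1)
    · have : Odd (y p) ↔ Even (x p) := by
        rw [a1, update_self, Int.odd_iff, Int.even_iff]; omega
      simp only [this]
      split_ifs <;> simp
    · by_cases a2 : y = update x p (x p - 1)
      · have : Odd (y p) ↔ Even (x p) := by
          rw [a2, update_self, Int.odd_iff, Int.even_iff]; omega
        simp only [this]
        split_ifs <;> simp
      · simp [a1, a2]
  rw [Finset.sum_congr rfl (fun y _ => h1 y), Finset.sum_add_distrib, Finset.sum_ite_eq',
    Finset.sum_ite_eq']
  unfold tcon
  simp only [mem_PP]
  split_ifs <;> simp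

lemma Kset_card_le {L : ℤ} (hL : Even L) {x : β × Fin (n + 1) → ℤ} (hx : inP L x)
    (ho : Fintype.card β * n ≤ oddc x + 1) (i : β) : (Kset L x i).card ≤ 2 := by
  classical
  have h1 : oddc x = ∑ j, (Finset.univ.filter fun q : Fin (n + 1) => Odd (x (j, q))).card := by
    unfold oddc
    simp only [Finset.card_filter]
    rw [Fintype.sum_prod_type]
  have h2 : ∀ j, (Finset.univ.filter fun q : Fin (n + 1) => Odd (x (j, q))).card +
      (Kset L x j).card ≤ n + 1 := by
    intro j
    rw [← Finset.card_union_of_disjoint]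
    · exact (Finset.card_le_univ _).trans (by simp)
    · rw [Finset.disjoint_left]
      intro q hq hq'
      simp only [Kset, Finset.mem_filter, Finset.mem_univ, true_and] at hq hq'
      rw [← hq', even_abs] at hL
      exact (Int.not_even_iff_odd.mpr hq) hL
  have h3 : ∀ j, 1 ≤ (Kset L x j).card := by
    intro j
    obtain ⟨q, hq⟩ := hx.2 j
    exact Finset.card_pos.mpr ⟨q, by simp [Kset, hq]⟩
  have h4 := Finset.sum_le_sum (fun j (_ : j ∈ Finset.univ) => h2 j)
  rw [Finset.sum_add_distrib, ← h1, ← Finset.add_sum_erase _ _ (Finset.mem_univ i)] at h4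
  have h5 := Finset.card_nsmul_le_sum (Finset.univ.erase i) (fun j => (Kset L x j).card) 1
    (fun j _ => h3 j)
  have h6 : (Finset.univ.erase i).card + 1 = Fintype.card β := by
    rw [Finset.card_erase_add_one (Finset.mem_univ i)]; rfl
  simp only [smul_eq_mul, mul_one, Finset.sum_const, Finset.card_univ, mul_add] at h4 h5
  omega

open Classical in
lemma tcon_eq {L : ℤ} (hL : Even L) (hL0 : 0 < L) {x : β × Fin (n + 1) → ℤ} (hx : inP L x)
    (i : β) (q : Fin (n + 1)) :
    tcon L x (i, q) = if q ∈ Kset L x i then (if 2 ≤ (Kset L x i).card then 1 else 0) else 0 := by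
  have hoth : ∀ z : ℤ, |z| ≤ L → (∃ q', q' ≠ q ∧ |x (i, q')| = L) →
      inP L (update x (i, q) z) := by
    rintro z hz ⟨q', hq', hq''⟩
    constructor
    · intro p
      by_cases hp : p = (i, q)
      · subst hp; simpa using hz
      · rw [update_of_ne hp]; exact hx.1 p
    · intro j
      by_cases hj : j = i
      · subst hj
        exact ⟨q', by rw [update_of_ne (by simp [hq'])]; exact hq''⟩
      · obtain ⟨r, hr⟩ := hx.2 j
        exact ⟨r, by rw [update_of_ne (by simp [hj])]; exact hr⟩
  by_cases hq : |x (i, q)| = L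
  · have hev : Even (x (i, q)) := by rw [← even_abs, hq]; exact hL
    have hmem : q ∈ Kset L x i := by simp [Kset, hq]
    rw [if_pos hmem]
    unfold tcon
    rw [if_pos hev]
    have hiff : 2 ≤ (Kset L x i).card ↔ ∃ q', q' ≠ q ∧ |x (i, q')| = L := by
      constructor
      · intro h
        obtain ⟨q', hq', hne⟩ := Finset.exists_mem_ne (s := Kset L x i) (by omega) q
        exact ⟨q', hne, by simpa [Kset] using hq'⟩
      · rintro ⟨q', hne, hq'⟩
        have : 1 < (Kset L x i).card := Finset.one_lt_card.mpr
          ⟨q', by simp [Kset, hq'], q, hmem, hne⟩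
        omega
    have hbig : ∀ z : ℤ, L < |z| → ¬ inP L (update x (i, q) z) := by
      intro z hz h
      have := h.1 (i, q)
      rw [update_self] at this; omega
    have hsmall : ∀ z : ℤ, |z| = L - 1 → (inP L (update x (i, q) z) ↔ 2 ≤ (Kset L x i).card) := by
      intro z hz
      rw [hiff]
      constructor
      · intro h
        obtain ⟨q', hq'⟩ := h.2 i
        by_cases hqq : q' = q
        · subst hqq; rw [update_self] at hq'; omega
        · rw [update_of_ne (by simp [hqq])] at hq'; exact ⟨q', hqq, hq'⟩
      · exact hoth z (by omega)
    rcases abs_eq hL0.le |>.mp hq with h | h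
    · rw [if_neg (hbig _ (by rw [h, abs_of_pos] <;> omega)),
        if_congr (hsmall _ (by rw [h, abs_of_nonneg] ; omega)) rfl rfl, zero_add]
    · rw [if_neg (hbig (x (i, q) - 1) (by rw [h, abs_of_neg] <;> omega)),
        if_congr (hsmall _ (by rw [h, abs_of_nonpos] <;> omega)) rfl rfl, add_zero]
  · have hmem : q ∉ Kset L x i := by simp [Kset, hq]
    rw [if_neg hmem]
    unfold tcon
    have hlt : |x (i, q)| < L := lt_of_le_of_ne (hx.1 _) hq
    have hex : ∃ q', q' ≠ q ∧ |x (i, q')| = L := by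
      obtain ⟨q', hq'⟩ := hx.2 i
      exact ⟨q', by rintro rfl; exact hq hq', hq'⟩
    rw [abs_lt] at hlt
    rw [if_pos (hoth _ (by rw [abs_le]; omega) hex), if_pos (hoth _ (by rw [abs_le]; omega) hex)]
    split_ifs
    · exact zmod2_add_self 1
    · rfl

open Classical in
lemma upsum_zero {L : ℤ} (hL : Even L) (hL0 : 0 < L) {x : β × Fin (n + 1) → ℤ} (hx : inP L x)
    (ho : Fintype.card β * n ≤ oddc x + 1) :
    ∑ y ∈ PP β n L, Bop (fun x' => if x' = x then 1 else 0) y = 0 := by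
  rw [upsum_eq, Fintype.sum_prod_type]
  refine Finset.sum_eq_zero fun i _ => ?_
  simp only [tcon_eq hL hL0 hx]
  have := Kset_card_le hL hx ho i
  rw [Finset.sum_ite_mem, Finset.univ_inter, Finset.sum_const]
  split_ifs with h
  · have h2 : (Kset L x i).card = 2 := by omega
    rw [h2]; decide
  · simp

lemma integ_Bop_zero {L : ℤ} (hL : Even L) (hL0 : 0 < L) {h : (β × Fin (n + 1) → ℤ) → ZMod 2}
    (hh : Inv L h) (hs : ∀ x, h x ≠ 0 → Fintype.card β * n ≤ oddc x + 1) :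
    integ L (Bop h) = 0 := by
  rw [integ_Bop_swap hL hL0 hh]
  refine Finset.sum_eq_zero fun x hx => ?_
  by_cases h0 : h x = 0
  · rw [h0]; ring
  · have := upsum_zero hL hL0 (mem_PP.mp hx) (hs x h0)
    rw [this, mul_zero]

lemma Inv.one (L : ℤ) : Inv L (fun _ : β × Fin (n + 1) → ℤ => (1 : ZMod 2)) := fun _ _ _ => rfl

lemma integ_middle {L : ℤ} (hL : Even L) (hL0 : 0 < L)
    {l l' : List ((β × Fin (n + 1) → ℤ) → ZMod 2)} {ψ : (β × Fin (n + 1) → ℤ) → ZMod 2}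
    (hψ : Inv L ψ) (hl : ∀ φ ∈ l, ∃ a, Twist L a φ) (hl' : ∀ φ ∈ l', ∃ a, Twist L a φ)
    (hlen : Fintype.card β * n = l.length + l'.length + 1) :
    integ L (Wop (l ++ ψ :: l') (fun _ => 1)) = 0 := by
  rw [Wop_middle]
  have h1 := Inv.Wop hL hl' (Inv.one L)
  refine integ_Bop_zero hL hL0 (Inv.Wop hL hl ?_) ?_
  · intro g y hy
    simp only [hψ g y hy, h1 g y hy]
  · intro x hx
    have := Wop_supp l (r := l'.length) ?_ x hx
    · omega
    · intro y hy
      have := Wop_supp l' (h := fun _ => 1) (r := 0) (by simp) y (right_ne_zero_of_mul hy)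
      omega

lemma Aop_add_left {ι : Type} [Fintype ι] [DecidableEq ι] (φ ψ h : (ι → ℤ) → ZMod 2) :
    Aop (fun x => φ x + ψ x) h = fun y => Aop φ h y + Aop ψ h y := by
  funext y
  unfold Aop
  have : (fun x => (φ x + ψ x) * h x) = fun x => φ x * h x + ψ x * h x := by
    funext x; ring
  rw [this, Bop_add]; ring

lemma Aop_add_right {ι : Type} [Fintype ι] [DecidableEq ι] (φ h k : (ι → ℤ) → ZMod 2) :
    Aop φ (fun x => h x + k x) = fun y => Aop φ h y + Aop φ k y := by
  funext y
  unfold Aop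
  have : (fun x => φ x * (h x + k x)) = fun x => φ x * h x + φ x * k x := by
    funext x; ring
  rw [this, Bop_add, Bop_add]; ring

lemma Wop_add {ι : Type} [Fintype ι] [DecidableEq ι] (l : List ((ι → ℤ) → ZMod 2))
    (h k : (ι → ℤ) → ZMod 2) : Wop l (fun x => h x + k x) = fun y => Wop l h y + Wop l k y := by
  induction l with
  | nil => rfl
  | cons φ l ih => rw [Wop_cons, ih, Aop_add_right]; rfl

lemma integ_add (L : ℤ) (h k : (β × Fin (n + 1) → ℤ) → ZMod 2) :
    integ L (fun x => h x + k x) = integ L h + integ L k := by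
  unfold integ
  rw [← Finset.sum_add_distrib]
  exact Finset.sum_congr rfl fun _ _ => by ring

/-- Replacement of labellings with the same characters. -/
lemma integ_replace {L : ℤ} (hL : Even L) (hL0 : 0 < L) {κ : Type}
    (a : κ → β → ZMod 2) (φ ψ : κ → (β × Fin (n + 1) → ℤ) → ZMod 2)
    (hφ : ∀ k, Twist L (a k) (φ k)) (hψ : ∀ k, Twist L (a k) (ψ k))
    (l l' : List κ) (hlen : Fintype.card β * n = l.length + l'.length) :
    integ L (Wop (l.map φ ++ l'.map ψ) (fun _ => 1)) =
      integ L (Wop ((l ++ l').map ψ) (fun _ => 1)) := by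
  induction l using List.reverseRecOn generalizing l' with
  | nil => simp
  | append_singleton l k ih =>
    have key := integ_middle (n := n) hL hL0 (l := l.map φ) (l' := l'.map ψ)
      (ψ := fun x => φ k x + ψ k x) ?_ ?_ ?_ ?_
    · have := ih (k :: l') (by simp at hlen ⊢; omega)
      simp only [List.append_assoc, List.singleton_append] at this ⊢
      rw [← this]
      simp only [List.map_append, List.map_cons, List.map_nil, List.append_assoc,
        List.singleton_append]
      rw [Wop_append, Wop_cons, Aop_add_left, Wop_add, integ_add] at key
      rw [Wop_append, Wop_append, Wop_cons, Wop_cons]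
      exact (by decide : ∀ u v : ZMod 2, u + v = 0 → u = v) _ _ key
    · intro g y hy
      simp only [hφ k g y hy, hψ k g y hy]
      have := zmod2_add_self (∑ i, a k i * g i)
      linear_combination this
    · intro χ hχ
      obtain ⟨k', -, rfl⟩ := List.mem_map.mp hχ
      exact ⟨_, hφ k'⟩
    · intro χ hχ
      obtain ⟨k', -, rfl⟩ := List.mem_map.mp hχ
      exact ⟨_, hψ k'⟩
    · simp at hlen ⊢; omega

end upsum
end Radon18

namespace Radon18
section block
variable {n : ℕ}

/-- Points of the boundary of one cube. -/
def inB (L : ℤ) (b : Fin (n + 1) → ℤ) : Prop := (∀ p, |b p| ≤ L) ∧ ∃ q, |b q| = L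

open Classical in
/-- `inB` as a finite set. -/
def BB (n : ℕ) (L : ℤ) : Finset (Fin (n + 1) → ℤ) :=
  (Fintype.piFinset fun _ => Finset.Icc (-L) L).filter (inB L)

lemma mem_BB {L : ℤ} {y : Fin (n + 1) → ℤ} : y ∈ BB n L ↔ inB L y := by
  classical
  unfold BB
  simp only [Finset.mem_filter, Fintype.mem_piFinset, Finset.mem_Icc, and_iff_right_iff_imp]
  intro h p
  exact abs_le.mp (h.1 p)

/-- Iterated standard operator on a block. -/
def Dop (r : ℕ) : (Fin (n + 1) → ℤ) → ZMod 2 := Wop (List.replicate r eps) (fun _ => 1)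

lemma Dop_succ (r : ℕ) : Dop (n := n) (r + 1) = Aop eps (Dop r) := rfl

lemma Dop_supp {r : ℕ} {b : Fin (n + 1) → ℤ} (h : Dop r b ≠ 0) : r ≤ oddc b := by
  have := Wop_supp (List.replicate r eps) (h := fun _ => 1) (r := 0) (by simp) b h
  simpa using this

lemma oddc_le {L : ℤ} (hL : Even L) {b : Fin (n + 1) → ℤ} (hb : inB L b) (hL0 : 0 < L) {s : ℕ}
    (h0 : ∀ p : Fin (n + 1), p.val + s < n → b p = 0) : oddc b ≤ s := by
  classical
  obtain ⟨q, hq⟩ := hb.2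
  have hqe : Even (b q) := by rw [← even_abs, hq]; exact hL
  have hq0 : b q ≠ 0 := by
    intro h; rw [h, abs_zero] at hq; omega
  have h1 : insert q (Finset.univ.filter fun p => Odd (b p)) ⊆
      Finset.univ.filter (fun p : Fin (n + 1) => n ≤ p.val + s) := by
    intro p hp
    simp only [Finset.mem_insert, Finset.mem_filter, Finset.mem_univ, true_and] at hp ⊢
    by_contra hlt
    have := h0 p (by omega)
    rcases hp with rfl | hp
    · exact hq0 this
    · rw [this] at hp; simp at hp
  have h2 := Finset.card_le_card h1
  rw [Finset.card_insert_of_notMem (by simpa using hqe)] at h2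
  have h3 : (Finset.univ.filter (fun p : Fin (n + 1) => n ≤ p.val + s)).card ≤
      (Finset.range (s + 1)).card := by
    refine Finset.card_le_card_of_injOn (fun p => n - p.val) ?_ ?_
    · intro p hp
      simp only [Finset.coe_filter, Finset.mem_univ, true_and, Set.mem_ofPred_eq] at hp
      simp only [Finset.coe_range, Set.mem_Iio]; omega
    · intro p _ p' _ hpp
      simp only at hpp
      ext; omega
  rw [Finset.card_range] at h3
  unfold oddc; omega

/-- The special point. -/
def bstar (L : ℤ) (r : ℕ) : Fin (n + 1) → ℤ := fun p =>
  if p.val = n then L else if n ≤ p.val + r then sg ((n - p.val : ℕ) : ZMod 2) else 0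

/-- Being plus or minus the special point. -/
def isStar (L : ℤ) (r : ℕ) (b : Fin (n + 1) → ℤ) : Prop :=
  ∃ σ : ZMod 2, b = fun p => sg σ * bstar L r p

lemma sg_ne (e : ZMod 2) : sg e ≠ 0 := by revert e; decide

lemma eps_sg_lt (e : ZMod 2) : (if sg e < 0 then (1 : ZMod 2) else 0) = e := by revert e; decide

lemma sg_inj {e f : ZMod 2} (h : sg e = sg f) : e = f := by revert e f; decide

lemma eps_bstar {L : ℤ} (hL0 : 0 < L) {r : ℕ} (hr : r ≤ n) :
    eps (bstar (n := n) L r) = (r : ZMod 2) := by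
  have hv : bstar (n := n) L r ⟨n - r, by omega⟩ = if r = 0 then L else sg (r : ZMod 2) := by
    unfold bstar
    by_cases h : r = 0
    · subst h; simp
    · rw [if_neg (by simp; omega), if_pos (by simp; omega), if_neg h]
      congr 2; simp; omega
  rw [eps_of_first (p := ⟨n - r, by omega⟩)]
  · rw [hv]
    by_cases h : r = 0
    · subst h; simp; omega
    · rw [if_neg h]; exact eps_sg_lt _
  · intro q hq
    have hq' : q.val < n - r := hq
    unfold bstar
    rw [if_neg (by omega), if_neg (by omega)]
  · rw [hv]; split_ifs
    · omega
    · exact sg_ne _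

lemma bstar_ne {L : ℤ} (hL0 : 0 < L) (r : ℕ) : ∃ q, bstar (n := n) L r q ≠ 0 :=
  ⟨⟨n, by omega⟩, by simp [bstar]; omega⟩

lemma bstar_succ {L : ℤ} {r : ℕ} (hr : r + 1 ≤ n) : bstar (n := n) L (r + 1) =
    update (bstar L r) ⟨n - (r + 1), by omega⟩ (sg ((r + 1 : ℕ) : ZMod 2)) := by
  funext p
  by_cases hp : p = ⟨n - (r + 1), by omega⟩
  · subst hp
    rw [update_self]
    unfold bstar
    rw [if_neg (by simp; omega), if_pos (by simp; omega)]
    congr 2; simp; omega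
  · rw [update_of_ne hp]
    have : p.val ≠ n - (r + 1) := fun h => hp (Fin.ext h)
    unfold bstar
    have e : n ≤ p.val + (r + 1) ↔ n ≤ p.val + r := by omega
    simp only [e]

lemma inB_down {L : ℤ} (hL : Even L) {y : Fin (n + 1) → ℤ} (h : inB L y)
    {p : Fin (n + 1)} (ho : Odd (y p)) (z : ℤ) (hz : |z| ≤ |y p|) : inB L (update y p z) := by
  have hne : |y p| ≠ L := by
    intro e
    rw [← e, even_abs] at hL
    exact (Int.not_even_iff_odd.mpr ho) hL
  constructor
  · intro q
    by_cases hq : q = p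
    · subst hq
      rw [update_self]
      exact hz.trans (h.1 q)
    · rw [update_of_ne hq]; exact h.1 q
  · obtain ⟨q, hq⟩ := h.2
    refine ⟨q, ?_⟩
    rw [update_of_ne]
    · exact hq
    · rintro rfl; exact hne hq

open Classical in
lemma Dop_succ_single {r : ℕ} {b : Fin (n + 1) → ℤ} {p0 : Fin (n + 1)}
    (h0 : ∀ q < p0, b q = 0) (hp0 : b p0 ≠ 0) :
    Dop (r + 1) b = if |b p0| = 1 then
      (eps (update b p0 0) + eps b) * Dop r (update b p0 0) else 0 := by
  rw [Dop_succ, Aop_eq]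
  have hsame : ∀ p z, p ≠ p0 → Odd (b p) → eps (update b p z) = eps b := by
    intro p z hp ho
    have hlt : p0 < p := by
      rcases lt_trichotomy p p0 with h | h | h
      · rw [h0 p h] at ho; simp at ho
      · exact absurd h hp
      · exact h
    rw [eps_of_first h0 hp0, eps_of_first (p := p0), update_of_ne hp.symm]
    · intro q hq; rw [update_of_ne (by rintro rfl; exact absurd hq (not_lt.mpr hlt.le))]; exact h0 q hq
    · rwa [update_of_ne hp.symm]
  have hsame0 : ∀ z : ℤ, z ≠ 0 → (z < 0 ↔ b p0 < 0) → eps (update b p0 z) = eps b := by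
    intro z hz hs
    rw [eps_of_first h0 hp0, eps_of_first (p := p0), update_self, if_congr hs rfl rfl]
    · intro q hq; rw [update_of_ne hq.ne]; exact h0 q hq
    · rwa [update_self]
  rw [Finset.sum_eq_single p0]
  · by_cases ho : Odd (b p0)
    · rw [if_pos ho]
      by_cases h1 : b p0 = 1
      · rw [h1, hsame0 (1 + 1) (by norm_num) (by rw [h1]; norm_num), zmod2_add_self]
        simp
      · by_cases h2 : b p0 = -1
        · rw [h2, hsame0 (-1 - 1) (by norm_num) (by rw [h2]; norm_num), zmod2_add_self]
          simp
        · rw [hsame0 (b p0 - 1) (by omega) (by omega), hsame0 (b p0 + 1) (by omega) (by omega),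
            zmod2_add_self, if_neg]
          · simp
          · intro h; rcases abs_eq (by norm_num) |>.mp h with h | h <;> omega
    · rw [if_neg ho, if_neg]
      intro h; rcases abs_eq (by norm_num) |>.mp h with h | h <;> rw [h] at ho <;> simp at ho
  · intro p _ hp
    by_cases ho : Odd (b p)
    · rw [if_pos ho, hsame p _ hp ho, hsame p _ hp ho, zmod2_add_self]; simp
    · rw [if_neg ho]
  · simp

open Classical in
lemma Dop_eq {L : ℤ} (hL : Even L) (hL0 : 0 < L) (r : ℕ) (hr : r ≤ n) (b : Fin (n + 1) → ℤ)
    (hb : inB L b) (h0 : ∀ p : Fin (n + 1), p.val + r < n → b p = 0) :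
    Dop r b = if isStar L r b then 1 else 0 := by
  induction r generalizing b with
  | zero =>
    rw [if_pos]
    · rfl
    · obtain ⟨q, hq⟩ := hb.2
      have hqn : q.val = n := by
        by_contra h
        have := h0 q (by omega)
        rw [this, abs_zero] at hq; omega
      have aux : ∀ σ : ZMod 2, b q = sg σ * L → isStar L 0 b := by
        intro σ hσ
        refine ⟨σ, ?_⟩
        funext p
        by_cases hp : p.val = n
        · have : p = q := Fin.ext (by omega)
          subst this
          rw [hσ]; simp [bstar, hp]
        · rw [h0 p (by omega)]
          unfold bstar
          rw [if_neg hp, if_neg (by omega)]; ring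
      rcases abs_eq hL0.le |>.mp hq with h | h
      · exact aux 0 (by rw [h]; simp [sg])
      · exact aux 1 (by rw [h]; have : sg 1 = -1 := by decide
                        rw [this]; ring)
  | succ r ih =>
    set p0 : Fin (n + 1) := ⟨n - (r + 1), by omega⟩ with hp0def
    have hstar0 : bstar L (r + 1) p0 = sg ((r + 1 : ℕ) : ZMod 2) := by
      rw [bstar_succ hr, update_self]
    have hstaro : ∀ p, p ≠ p0 → bstar L (r + 1) p = bstar L r p := by
      intro p hp
      rw [bstar_succ hr, update_of_ne hp]
    have hb0 : bstar L r p0 = 0 := by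
      unfold bstar
      rw [if_neg (by simp [hp0def]; omega), if_neg (by simp [hp0def]; omega)]
    by_cases hz : b p0 = 0
    · have h1 : oddc b ≤ r := by
        refine oddc_le hL hb hL0 fun p hp => ?_
        by_cases hpp : p = p0
        · rw [hpp, hz]
        · refine h0 p ?_
          have : p.val ≠ n - (r + 1) := fun h => hpp (Fin.ext h)
          omega
      rw [if_neg]
      · by_contra h
        have := Dop_supp h; omega
      · rintro ⟨σ, hσ⟩
        have := congrFun hσ p0
        rw [hz, hstar0] at this
        exact mul_ne_zero (sg_ne _) (sg_ne _) this.symm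
    · have hfirst : ∀ q < p0, b q = 0 := by
        intro q hq
        have : q.val < n - (r + 1) := hq
        exact h0 q (by omega)
      rw [Dop_succ_single hfirst hz]
      by_cases h1 : |b p0| = 1
      · rw [if_pos h1]
        obtain ⟨ω, hω⟩ : ∃ ω, b p0 = sg ω := by
          rcases abs_eq (by norm_num) |>.mp h1 with h | h
          · exact ⟨0, by rw [h]; decide⟩
          · exact ⟨1, by rw [h]; decide⟩
        have heb : eps b = ω := by
          rw [eps_of_first hfirst hz, hω, eps_sg_lt]
        have hodd : Odd (b p0) := by
          rw [hω]; rcases sg_cases ω with h | h <;> rw [h] <;> simp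
        rw [heb, ih (by omega) _ (inB_down hL hb hodd 0 (by simp)) ?_]
        · have hex : ∀ σ : ZMod 2, (update b p0 0 = fun p => sg σ * bstar L r p) →
              eps (update b p0 0) = r + σ := by
            intro σ h
            rw [h, eps_sg (bstar_ne hL0 r), eps_bstar hL0 (by omega)]
          by_cases hs : isStar L (r + 1) b
          · rw [if_pos hs]
            obtain ⟨τ, hτ⟩ := hs
            have hx : update b p0 0 = fun p => sg τ * bstar L r p := by
              funext p
              by_cases hp : p = p0
              · subst hp; rw [update_self, hb0, mul_zero]
              · rw [update_of_ne hp, congrFun hτ p, hstaro p hp]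
            rw [if_pos ⟨τ, hx⟩, hex τ hx]
            have := congrFun hτ p0
            rw [hω, hstar0, ← sg_add] at this
            rw [sg_inj this]
            push_cast
            exact (by decide : ∀ r t : ZMod 2, (r + t + (t + (r + 1))) * 1 = 1) _ _
          · rw [if_neg hs]
            by_cases hx : isStar L r (update b p0 0)
            · rw [if_pos hx]
              obtain ⟨σ, hσ⟩ := hx
              rw [hex σ hσ]
              have hne : ω ≠ σ + (r + 1) := by
                intro he
                apply hs
                refine ⟨σ, ?_⟩
                funext p
                by_cases hp : p = p0
                · subst hp; rw [hω, hstar0, ← sg_add, he]; push_cast; rfl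
                · have := congrFun hσ p
                  rw [update_of_ne hp] at this
                  rw [this, hstaro p hp]
              generalize (r : ZMod 2) = r' at hne ⊢
              clear hex hσ heb hω
              revert r' σ ω; decide
            · rw [if_neg hx, mul_zero]
        · intro p hp
          by_cases hpp : p = p0
          · rw [hpp, update_self]
          · rw [update_of_ne hpp]
            refine h0 p ?_
            have : p.val ≠ n - (r + 1) := fun h => hpp (Fin.ext h)
            omega
      · rw [if_neg h1, if_neg]
        rintro ⟨σ, hσ⟩
        apply h1
        rw [congrFun hσ p0, hstar0, abs_mul, abs_sg, abs_sg]; rfl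

/-- Block integral. -/
def Eint (n : ℕ) (L : ℤ) (r : ℕ) : ZMod 2 := ∑ b ∈ BB n L, (1 + eps b) * Dop r b

lemma Eint_gt {L : ℤ} (hL : Even L) (hL0 : 0 < L) {r : ℕ} (hr : n < r) : Eint n L r = 0 := by
  unfold Eint
  refine Finset.sum_eq_zero fun b hb => ?_
  by_cases h : Dop r b = 0
  · rw [h, mul_zero]
  · have h1 := Dop_supp h
    have h2 := oddc_le hL (mem_BB.mp hb) hL0 (s := n) (fun p hp => by omega)
    omega

lemma Eint_n {L : ℤ} (hL : Even L) (hL0 : 0 < L) (hL1 : 1 ≤ L) : Eint n L n = 1 := by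
  classical
  unfold Eint
  set v : ZMod 2 → (Fin (n + 1) → ℤ) := fun σ p => sg σ * bstar L n p with hv
  have hvin : ∀ σ, v σ ∈ BB n L := by
    intro σ
    rw [mem_BB]
    constructor
    · intro p
      simp only [hv, abs_mul, abs_sg, one_mul]
      unfold bstar
      split_ifs
      · rw [abs_of_pos hL0]
      · rw [abs_sg]; exact hL1
      · rw [abs_zero]; exact hL0.le
    · exact ⟨⟨n, by omega⟩, by simp [hv, abs_mul, abs_sg, bstar, abs_of_pos hL0]⟩
  have hve : ∀ σ, eps (v σ) = n + σ := by
    intro σ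
    simp only [hv]
    rw [eps_sg (bstar_ne hL0 n), eps_bstar hL0 le_rfl]
  have hvinj : v 0 ≠ v 1 := by
    intro h
    have h1 := hve 0
    rw [h, hve 1] at h1
    simp at h1
  rw [← Finset.sum_subset (s₁ := {v 0, v 1})]
  · rw [Finset.sum_pair hvinj, hve, hve, Dop_eq hL hL0 n le_rfl _ (mem_BB.mp (hvin 0)) (by omega),
      Dop_eq hL hL0 n le_rfl _ (mem_BB.mp (hvin 1)) (by omega), if_pos ⟨0, rfl⟩, if_pos ⟨1, rfl⟩]
    generalize (n : ZMod 2) = r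
    revert r; decide
  · intro b hb
    simp only [Finset.mem_insert, Finset.mem_singleton] at hb
    rcases hb with rfl | rfl <;> exact hvin _
  · intro b hb hnb
    rw [Dop_eq hL hL0 n le_rfl _ (mem_BB.mp hb) (by omega), if_neg, mul_zero]
    rintro ⟨σ, hσ⟩
    apply hnb
    have : σ = 0 ∨ σ = 1 := by clear hσ; revert σ; decide
    rcases this with rfl | rfl <;> simp [hσ, hv]

end block
end Radon18

namespace Radon18
section prod
variable {β : Type} [Fintype β] [DecidableEq β] {n : ℕ}

/-- Product functions. -/
def hprod (n : ℕ) (r : β →₀ ℕ) (y : β × Fin (n + 1) → ℤ) : ZMod 2 := ∏ i, Dop (r i) (blk y i)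

lemma blk_update_same (y : β × Fin (n + 1) → ℤ) (i : β) (q z) :
    blk (update y (i, q) z) i = update (blk y i) q z := by
  funext q'
  unfold blk
  by_cases h : q' = q
  · subst h; simp
  · rw [update_of_ne h, update_of_ne (by simp [h])]

lemma blk_update_ne (y : β × Fin (n + 1) → ℤ) {i j : β} (h : j ≠ i) (q z) :
    blk (update y (i, q) z) j = blk y j := by
  funext q'
  unfold blk
  rw [update_of_ne (by simp [h])]

lemma hprod_split (r : β →₀ ℕ) (y : β × Fin (n + 1) → ℤ) (i : β) :
    hprod n r y = Dop (r i) (blk y i) * ∏ j ∈ Finset.univ.erase i, Dop (r j) (blk y j) := by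
  unfold hprod
  rw [Finset.mul_prod_erase _ (fun j => Dop (r j) (blk y j)) (Finset.mem_univ i)]

lemma Aop_hprod (r : β →₀ ℕ) (i : β) :
    Aop (fun y => eps (blk y i)) (hprod n r) = hprod n (Finsupp.single i 1 + r) := by
  funext y
  rw [hprod_split _ y i, Aop_eq]
  have h1 : ∏ j ∈ Finset.univ.erase i, Dop ((Finsupp.single i 1 + r : β →₀ ℕ) j) (blk y j) =
      ∏ j ∈ Finset.univ.erase i, Dop (r j) (blk y j) := by
    refine Finset.prod_congr rfl fun j hj => ?_
    have : i ≠ j := (Finset.ne_of_mem_erase hj).symm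
    simp [Finsupp.single_eq_of_ne' this]
  have h2 : (Finsupp.single i 1 + r : β →₀ ℕ) i = r i + 1 := by simp [add_comm]
  rw [h1, h2, Dop_succ, Aop_eq, Fintype.sum_prod_type, Finset.sum_eq_single i, Finset.sum_mul]
  · refine Finset.sum_congr rfl fun q _ => ?_
    have h3 : ∀ z, hprod n r (update y (i, q) z) = Dop (r i) (update (blk y i) q z) *
        ∏ j ∈ Finset.univ.erase i, Dop (r j) (blk y j) := by
      intro z
      rw [hprod_split _ _ i, blk_update_same]
      congr 1
      refine Finset.prod_congr rfl fun j hj => ?_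
      rw [blk_update_ne _ (Finset.ne_of_mem_erase hj)]
    have h4 : blk y i q = y (i, q) := rfl
    rw [h3, h3, blk_update_same, blk_update_same, h4]
    split_ifs <;> ring
  · intro j _ hj
    refine Finset.sum_eq_zero fun q _ => ?_
    rw [blk_update_ne _ hj.symm, blk_update_ne _ hj.symm, zmod2_add_self]
    simp
  · simp

lemma integ_hprod (L : ℤ) (r : β →₀ ℕ) : integ L (hprod n r) = ∏ i, Eint n L (r i) := by
  unfold Eint
  rw [Finset.prod_univ_sum]
  unfold integ
  refine Finset.sum_nbij' (fun y => blk y) (fun b p => b p.1 p.2) ?_ ?_ ?_ ?_ ?_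
  · intro y hy
    rw [mem_PP] at hy
    rw [Fintype.mem_piFinset]
    intro i
    rw [mem_BB]
    exact ⟨fun q => hy.1 (i, q), hy.2 i⟩
  · intro b hb
    rw [Fintype.mem_piFinset] at hb
    rw [mem_PP]
    exact ⟨fun p => (mem_BB.mp (hb p.1)).1 p.2, fun i => (mem_BB.mp (hb i)).2⟩
  · intro y _; rfl
  · intro b _; rfl
  · intro y _
    unfold kap hprod
    rw [Finset.prod_mul_distrib]

/-- Linear map from polynomials to functions. -/
def Tht (β : Type) [Fintype β] [DecidableEq β] (n : ℕ) :
    MvPolynomial β (ZMod 2) →ₗ[ZMod 2] ((β × Fin (n + 1) → ℤ) → ZMod 2) :=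
  (MvPolynomial.basisMonomials β (ZMod 2)).constr (ZMod 2) (hprod n)

lemma Tht_monomial (r : β →₀ ℕ) (c : ZMod 2) :
    Tht β n (MvPolynomial.monomial r c) = c • hprod n r := by
  have h1 : MvPolynomial.monomial r c = c • MvPolynomial.basisMonomials β (ZMod 2) r := by
    rw [MvPolynomial.coe_basisMonomials, MvPolynomial.smul_monomial, smul_eq_mul, mul_one]
  rw [h1, map_smul]
  congr 1
  exact Module.Basis.constr_basis _ _ _ _

/-- Linear form. -/
def lform (a : β → ZMod 2) : MvPolynomial β (ZMod 2) := ∑ i, MvPolynomial.C (a i) * MvPolynomial.X i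

/-- Standard labelling. -/
def stdl (n : ℕ) (a : β → ZMod 2) : (β × Fin (n + 1) → ℤ) → ZMod 2 := fun y => ∑ i, a i * eps (blk y i)

lemma Aop_const_mul_right {ι : Type} [Fintype ι] [DecidableEq ι] (φ h : (ι → ℤ) → ZMod 2) (c : ZMod 2) :
    Aop φ (fun x => c * h x) = fun y => c * Aop φ h y := by
  funext y
  rw [Aop_eq, Aop_eq, Finset.mul_sum]
  refine Finset.sum_congr rfl fun p _ => ?_
  split_ifs <;> ring

lemma Aop_sum_left {ι κ : Type} [Fintype ι] [DecidableEq ι] [Fintype κ] (a : κ → ZMod 2)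
    (φ : κ → (ι → ℤ) → ZMod 2) (h : (ι → ℤ) → ZMod 2) (y) :
    Aop (fun x => ∑ k, a k * φ k x) h y = ∑ k, a k * Aop (φ k) h y := by
  simp only [Aop_eq, Finset.mul_sum]
  rw [Finset.sum_comm]
  refine Finset.sum_congr rfl fun p _ => ?_
  by_cases ho : Odd (y p)
  · simp only [if_pos ho]
    rw [← Finset.sum_add_distrib, ← Finset.sum_add_distrib, Finset.sum_mul, Finset.sum_mul,
      ← Finset.sum_add_distrib]
    exact Finset.sum_congr rfl fun k _ => by ring
  · simp [ho]

lemma Aop_stdl (a : β → ZMod 2) (p : MvPolynomial β (ZMod 2)) :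
    Aop (stdl n a) (Tht β n p) = Tht β n (lform a * p) := by
  induction p using MvPolynomial.induction_on' with
  | monomial u c =>
    have h1 : lform a * MvPolynomial.monomial u c =
        ∑ i, a i • MvPolynomial.monomial (Finsupp.single i 1 + u) c := by
      unfold lform
      rw [Finset.sum_mul]
      refine Finset.sum_congr rfl fun i _ => ?_
      rw [MvPolynomial.C_mul_X_eq_monomial, MvPolynomial.monomial_mul, MvPolynomial.smul_monomial]
      rfl
    rw [h1, map_sum, Tht_monomial]
    have : (c • hprod n u) = fun x => c * hprod n u x := rfl
    rw [this, Aop_const_mul_right]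
    funext y
    unfold stdl
    rw [Aop_sum_left]
    simp only [map_smul, Tht_monomial, ← Aop_hprod, Finset.sum_apply, Pi.smul_apply, smul_eq_mul]
    rw [Finset.mul_sum]
    exact Finset.sum_congr rfl fun i _ => by ring
  | add p q hp hq =>
    rw [map_add, mul_add, map_add, ← hp, ← hq]
    exact Aop_add_right _ _ _

lemma Wop_stdl (l : List (β → ZMod 2)) :
    Wop (l.map (stdl n)) (fun _ => 1) = Tht β n (l.map lform).prod := by
  induction l with
  | nil =>
    rw [List.map_nil, List.map_nil, List.prod_nil, ← MvPolynomial.C_1, MvPolynomial.C_apply,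
      Tht_monomial, one_smul]
    funext y
    unfold hprod
    symm
    exact Finset.prod_eq_one fun i _ => rfl
  | cons a l ih =>
    rw [List.map_cons, Wop_cons, ih, Aop_stdl, List.map_cons, List.prod_cons]

lemma integ_sum {κ : Type} (L : ℤ) (s : Finset κ) (a : κ → ZMod 2)
    (h : κ → (β × Fin (n + 1) → ℤ) → ZMod 2) :
    integ L (∑ k ∈ s, a k • h k) = ∑ k ∈ s, a k * integ L (h k) := by
  unfold integ
  simp only [Finset.mul_sum, Finset.sum_apply, Pi.smul_apply, smul_eq_mul]
  rw [Finset.sum_comm]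
  exact Finset.sum_congr rfl fun _ _ => Finset.sum_congr rfl fun _ _ => by ring

lemma lform_homog (a : β → ZMod 2) : (lform a).IsHomogeneous 1 := by
  unfold lform
  refine MvPolynomial.IsHomogeneous.sum _ _ _ fun i _ => ?_
  simpa using (MvPolynomial.isHomogeneous_C β (a i)).mul (MvPolynomial.isHomogeneous_X (ZMod 2) i)

lemma lprod_homog (l : List (β → ZMod 2)) : ((l.map lform).prod).IsHomogeneous l.length := by
  induction l with
  | nil => simpa using MvPolynomial.isHomogeneous_one β (ZMod 2)
  | cons a l ih =>
    rw [List.map_cons, List.prod_cons, List.length_cons, add_comm]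
    exact (lform_homog a).mul ih

/-- The constant exponent. -/
def cexp (β : Type) [Fintype β] (n : ℕ) : β →₀ ℕ := Finsupp.equivFunOnFinite.symm fun _ => n

lemma integ_Tht {L : ℤ} (hL : Even L) (hL0 : 0 < L) (p : MvPolynomial β (ZMod 2))
    (hp : p.IsHomogeneous (Fintype.card β * n)) :
    integ L (Tht β n p) = p.coeff (cexp β n) := by
  have h1 : Tht β n p = ∑ r ∈ p.support, p.coeff r • hprod n r := by
    conv_lhs => rw [← p.support_sum_monomial_coeff]
    rw [map_sum]
    exact Finset.sum_congr rfl fun r _ => Tht_monomial _ _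
  rw [h1, integ_sum]
  have h2 : ∏ i, Eint n L (cexp β n i) = 1 := by
    refine Finset.prod_eq_one fun i _ => ?_
    exact Eint_n hL hL0 hL0
  have h3 : ∀ r ∈ p.support, r ≠ cexp β n → p.coeff r * integ L (hprod n r) = 0 := by
    intro r hr hne
    rw [integ_hprod]
    have hdeg : ∑ i, r i = Fintype.card β * n := by
      have := hp (MvPolynomial.mem_support_iff.mp hr)
      rw [← this, Finsupp.weight_apply, Finsupp.sum_fintype] <;> simp
    have : ∃ i, n < r i := by
      by_contra hcon
      push Not at hcon
      apply hne
      ext i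
      have heq := (Finset.sum_eq_sum_iff_of_le (f := r) (g := fun _ => n)
        (s := Finset.univ) (fun i _ => hcon i)).mp (by rw [hdeg]; simp)
      exact heq i (Finset.mem_univ i)
    obtain ⟨i, hi⟩ := this
    rw [Finset.prod_eq_zero (Finset.mem_univ i) (Eint_gt hL hL0 hi), mul_zero]
  by_cases hs : cexp β n ∈ p.support
  · rw [Finset.sum_eq_single_of_mem _ hs h3, integ_hprod, h2, mul_one]
  · rw [MvPolynomial.notMem_support_iff.mp hs]
    refine Finset.sum_eq_zero fun r hr => h3 r hr ?_
    rintro rfl; exact hs hr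

lemma stdl_twist {L : ℤ} (hL0 : 0 < L) (a : β → ZMod 2) : Twist L a (stdl n a) := by
  intro g y hy
  unfold stdl
  rw [← Finset.sum_add_distrib]
  refine Finset.sum_congr rfl fun i _ => ?_
  rw [blk_act, eps_sg (blk_ne hL0 hy i)]; ring

/-- Points reached by a nonvanishing word. -/
lemma Wop_reach {L : ℤ} (hL : Even L) (l : List ((β × Fin (n + 1) → ℤ) → ZMod 2))
    (y : β × Fin (n + 1) → ℤ) (hy : inP L y) (h : Wop l (fun _ => 1) y ≠ 0) :
    ∀ φ ∈ l, ∃ x x', inP L x ∧ inP L x' ∧ (∀ p, |x p - y p| ≤ l.length) ∧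
      (∀ p, |x' p - y p| ≤ l.length) ∧ φ x ≠ φ x' := by
  induction l generalizing y with
  | nil => simp
  | cons ψ l ih =>
    rw [Wop_cons] at h
    obtain ⟨p, z, ho, hz, h1, h2⟩ := Aop_step h
    have hin := inP_down hL hy ho hz
    have hclose : ∀ q, |update y p z q - y q| ≤ 1 := by
      intro q
      by_cases hq : q = p
      · subst hq; rw [update_self, hz]
      · rw [update_of_ne hq]; simp
    intro φ hφ
    rw [List.mem_cons] at hφ
    rcases hφ with rfl | hφ
    · refine ⟨_, y, hin, hy, fun q => (hclose q).trans ?_, fun q => ?_, h1⟩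
      · simp
      · simp; positivity
    · obtain ⟨x, x', a1, a2, a3, a4, a5⟩ := ih _ hin h2 φ hφ
      refine ⟨x, x', a1, a2, fun q => ?_, fun q => ?_, a5⟩
      · have := abs_sub_le (x q) (update y p z q) (y q)
        have := a3 q
        have := hclose q
        push_cast [List.length_cons]; omega
      · have := abs_sub_le (x' q) (update y p z q) (y q)
        have := a4 q
        have := hclose q
        push_cast [List.length_cons]; omega

/-- The combinatorial theorem. -/
theorem combi {L : ℤ} (hL : Even L) (hL0 : 0 < L) {κ : Type} [Fintype κ]
    (a : κ → β → ZMod 2) (φ : κ → (β × Fin (n + 1) → ℤ) → ZMod 2)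
    (hφ : ∀ k, Twist L (a k) (φ k)) (hcard : Fintype.card κ = Fintype.card β * n)
    (hco : (∏ k, lform (a k)).coeff (cexp β n) ≠ 0) :
    ∃ y : β × Fin (n + 1) → ℤ, inP L y ∧ ∀ k, ∃ x x', inP L x ∧ inP L x' ∧
      (∀ p, |x p - y p| ≤ Fintype.card κ) ∧
      (∀ p, |x' p - y p| ≤ Fintype.card κ) ∧ φ k x ≠ φ k x' := by
  classical
  set l : List κ := Finset.univ.toList with hl
  have hlen : l.length = Fintype.card κ := by simp [hl]
  have h1 := integ_replace hL hL0 a φ (fun k => stdl n (a k)) hφ (fun k => stdl_twist hL0 (a k))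
    l [] (by simp [hlen, hcard])
  have h2 : (l.map fun k => stdl n (a k)) = (l.map a).map (stdl n) := by simp
  simp only [List.map_nil, List.append_nil] at h1
  rw [h2, Wop_stdl, integ_Tht hL hL0] at h1
  · have h3 : ((l.map a).map lform).prod = ∏ k, lform (a k) := by
      rw [List.map_map, hl]
      exact Finset.prod_map_toList Finset.univ _
    rw [h3] at h1
    have h4 : integ L (Wop (l.map φ) fun _ => 1) ≠ 0 := by rw [h1]; exact hco
    unfold integ at h4
    obtain ⟨y, hy, hy'⟩ := Finset.exists_ne_zero_of_sum_ne_zero h4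
    rw [mem_PP] at hy
    refine ⟨y, hy, fun k => ?_⟩
    obtain ⟨x, x', a1, a2, a3, a4, a5⟩ := Wop_reach hL _ y hy (right_ne_zero_of_mul hy') (φ k)
      (List.mem_map_of_mem (by simp [hl]))
    rw [List.length_map, hlen] at a3 a4
    exact ⟨x, x', a1, a2, a3, a4, a5⟩
  · have := lprod_homog (l.map a)
    rwa [List.length_map, hlen, hcard] at this

end prod
end Radon18

namespace Radon18
section cont
variable {β : Type} [Fintype β] [DecidableEq β] {n : ℕ}

/-- Product of unit spheres for the supremum norm. -/
def Sph (β : Type) (n : ℕ) : Set (β × Fin (n + 1) → ℝ) :=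
  {x | (∀ p, |x p| ≤ 1) ∧ ∀ i, ∃ q, |x (i, q)| = 1}

/-- Real sign action. -/
def actR (g : β → ZMod 2) (x : β × Fin (n + 1) → ℝ) : β × Fin (n + 1) → ℝ :=
  fun p => (sg (g p.1) : ℝ) * x p

lemma Sph_compact : IsCompact (Sph β n) := by
  refine Metric.isCompact_of_isClosed_isBounded ?_ ?_
  · have : Sph β n = (⋂ p, {x | |x p| ≤ 1}) ∩ ⋂ i, ⋃ q, {x | |x (i, q)| = 1} := by
      ext x; simp [Sph]
    rw [this]
    refine IsClosed.inter (isClosed_iInter fun p => ?_) (isClosed_iInter fun i =>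
      isClosed_iUnion_of_finite fun q => ?_)
    · exact isClosed_le (by fun_prop) (by fun_prop)
    · exact isClosed_eq (by fun_prop) (by fun_prop)
  · refine (Metric.isBounded_closedBall (x := (0 : β × Fin (n + 1) → ℝ)) (r := 1)).subset ?_
    intro x hx
    rw [mem_closedBall_zero_iff, pi_norm_le_iff_of_nonneg zero_le_one]
    intro p
    exact hx.1 p

/-- Scaling of lattice points. -/
def scl (L : ℤ) (y : β × Fin (n + 1) → ℤ) : β × Fin (n + 1) → ℝ := fun p => (y p : ℝ) / L

lemma scl_mem {L : ℤ} (hL : 0 < L) {y : β × Fin (n + 1) → ℤ} (hy : inP L y) :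
    scl L y ∈ Sph β n := by
  have hL' : (0 : ℝ) < L := by exact_mod_cast hL
  constructor
  · intro p
    simp only [scl, abs_div, abs_of_pos hL']
    rw [div_le_one hL']
    exact_mod_cast hy.1 p
  · intro i
    obtain ⟨q, hq⟩ := hy.2 i
    refine ⟨q, ?_⟩
    simp only [scl, abs_div, abs_of_pos hL']
    rw [div_eq_one_iff_eq hL'.ne']
    exact_mod_cast hq

lemma scl_act (L : ℤ) (g : β → ZMod 2) (y : β × Fin (n + 1) → ℤ) :
    scl L (act g y) = actR g (scl L y) := by
  funext p
  simp only [scl, act, actR]; push_cast; ring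

lemma scl_dist {L : ℤ} (hL : 0 < L) {x y : β × Fin (n + 1) → ℤ} {M : ℕ} {δ : ℝ} (hδ : 0 < δ)
    (h : ∀ p, |x p - y p| ≤ M) (hM : (M : ℝ) < δ * L) : dist (scl L x) (scl L y) < δ := by
  have hL' : (0 : ℝ) < L := by exact_mod_cast hL
  rw [dist_pi_lt_iff hδ]
  intro p
  rw [Real.dist_eq]
  simp only [scl]
  rw [← sub_div, abs_div, abs_of_pos hL', div_lt_iff₀ hL']
  refine lt_of_le_of_lt ?_ hM
  exact_mod_cast h p

lemma card_of_coeff {κ : Type} [Fintype κ] (a : κ → β → ZMod 2)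
    (hco : (∏ k, lform (a k)).coeff (cexp β n) ≠ 0) :
    Fintype.card κ = Fintype.card β * n := by
  have h1 : (∏ k, lform (a k)).IsHomogeneous (∑ _k : κ, 1) :=
    MvPolynomial.IsHomogeneous.prod _ _ _ fun k _ => lform_homog (a k)
  have := h1 hco
  rw [Finsupp.weight_apply, Finsupp.sum_fintype] at this
  · simpa [cexp] using this.symm
  · simp

set_option maxHeartbeats 1000000 in
theorem common_zero {κ : Type} [Fintype κ] (a : κ → β → ZMod 2)
    (f : κ → (β × Fin (n + 1) → ℝ) → ℝ) (hf : ∀ k, ContinuousOn (f k) (Sph β n))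
    (heq : ∀ k g, ∀ x ∈ Sph β n, f k (actR g x) = (sg (∑ i, a k i * g i) : ℝ) * f k x)
    (hco : (∏ k, lform (a k)).coeff (cexp β n) ≠ 0) :
    ∃ x ∈ Sph β n, ∀ k, f k x = 0 := by
  classical
  have hcard := card_of_coeff a hco
  set M := Fintype.card κ with hM
  -- approximate zeros
  have approx : ∀ η : ℝ, 0 < η → ∃ x ∈ Sph β n, ∀ k, |f k x| ≤ η := by
    intro η hη
    have huc : ∀ k, ∃ δ > 0, ∀ x ∈ Sph β n, ∀ y ∈ Sph β n, dist x y < δ → dist (f k x) (f k y) < η := by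
      intro k
      have := Metric.uniformContinuousOn_iff.mp (Sph_compact.uniformContinuousOn_of_continuous (hf k)) η hη
      exact this
    choose δ hδ hδ' using huc
    obtain ⟨l, hl⟩ : ∃ l : ℕ, ∀ k, (M : ℝ) / δ k ≤ l := by
      obtain ⟨l, hl⟩ := exists_nat_ge (∑ k, (M : ℝ) / δ k)
      refine ⟨l, fun k => le_trans ?_ hl⟩
      exact Finset.single_le_sum (f := fun k => (M : ℝ) / δ k)
        (fun i _ => div_nonneg (Nat.cast_nonneg _) (hδ i).le) (Finset.mem_univ k)
    set L : ℤ := 2 * (l + 1) with hLdef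
    have hLe : Even L := ⟨l + 1, by rw [hLdef]; ring⟩
    have hL0 : 0 < L := by positivity
    have hLM : ∀ k, (M : ℝ) < δ k * L := by
      intro k
      have h1 := hl k
      rw [div_le_iff₀ (hδ k)] at h1
      have : (L : ℝ) = 2 * (l + 1) := by rw [hLdef]; push_cast; ring
      rw [this]
      nlinarith [hδ k, (Nat.cast_nonneg l : (0 : ℝ) ≤ l)]
    set φ : κ → (β × Fin (n + 1) → ℤ) → ZMod 2 := fun k y =>
      if 0 < f k (scl L y) then 0 else if f k (scl L y) < 0 then 1 else stdl n (a k) y with hφ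
    have htw : ∀ k, Twist L (a k) (φ k) := by
      intro k g y hy
      have e := heq k g _ (scl_mem hL0 hy)
      rw [← scl_act] at e
      have hst := stdl_twist hL0 (a k) g y hy
      simp only [hφ, e, hst]
      generalize (∑ i, a k i * g i) = s
      have hs : s = 0 ∨ s = 1 := by revert s; decide
      rcases hs with rfl | rfl
      · simp [sg]
      · have : ((sg 1 : ℤ) : ℝ) = -1 := by simp [sg]
        rw [this]
        rcases lt_trichotomy (f k (scl L y)) 0 with h | h | h
        · rw [if_pos (by linarith), if_neg (by linarith), if_pos h]; decide
        · rw [h]; simp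
        · rw [if_neg (by linarith), if_pos (by linarith), if_pos h]; decide
    obtain ⟨y, hy, hyk⟩ := combi hLe hL0 a φ htw hcard hco
    refine ⟨scl L y, scl_mem hL0 hy, fun k => ?_⟩
    obtain ⟨x, x', hx, hx', hd, hd', hne⟩ := hyk k
    have d1 := hδ' k _ (scl_mem hL0 hx) _ (scl_mem hL0 hy) (scl_dist hL0 (hδ k) hd (hLM k))
    have d2 := hδ' k _ (scl_mem hL0 hx') _ (scl_mem hL0 hy) (scl_dist hL0 (hδ k) hd' (hLM k))
    rw [Real.dist_eq, abs_lt] at d1 d2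
    simp only [hφ] at hne
    rw [abs_le]
    rcases lt_trichotomy (f k (scl L x)) 0 with h | h | h
    · have : ¬ f k (scl L x') < 0 := by
        intro h'
        apply hne
        rw [if_neg h.le.not_gt, if_pos h, if_neg h'.le.not_gt, if_pos h']
      constructor <;> linarith
    · constructor <;> linarith
    · have : ¬ 0 < f k (scl L x') := by
        intro h'
        apply hne
        rw [if_pos h, if_pos h']
      constructor <;> linarith
  obtain ⟨x1, hx1, -⟩ := approx 1 one_pos
  have hc : ContinuousOn (fun x => ∑ k, |f k x|) (Sph β n) :=
    continuousOn_finsetSum _ fun k _ => (hf k).abs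
  obtain ⟨x0, hx0, hmin⟩ := Sph_compact.exists_isMinOn ⟨x1, hx1⟩ hc
  refine ⟨x0, hx0, ?_⟩
  have hz : ∑ k, |f k x0| ≤ 0 := by
    refine le_of_forall_pos_le_add fun ε hε => ?_
    obtain ⟨x, hx, hxk⟩ := approx (ε / (M + 1)) (by positivity)
    have h1 : ∑ k, |f k x0| ≤ ∑ k, |f k x| := hmin hx
    have h2 : ∑ k, |f k x| ≤ ∑ _k : κ, ε / (M + 1) := Finset.sum_le_sum fun k _ => hxk k
    rw [Finset.sum_const, Finset.card_univ, nsmul_eq_mul, ← hM] at h2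
    have h3 : (M : ℝ) * (ε / (M + 1)) ≤ ε := by
      rw [← mul_div_assoc, div_le_iff₀ (by positivity)]
      nlinarith
    linarith
  intro k
  have h1 := Finset.single_le_sum (f := fun k => |f k x0|) (fun i _ => abs_nonneg _) (Finset.mem_univ k)
  have : |f k x0| ≤ 0 := h1.trans hz
  exact abs_nonpos_iff.mp this

end cont
end Radon18

namespace Radon18
section poly

lemma H_expand {R : Type} [CommRing R] (h2 : (2 : R) = 0) (a b c d : R) :
    (c) * (b) * (b + c) * (a) * (a + d) * (a + b) * (a + b + d) * (a + b + c) =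
      a^1 * b^2 * c^3 * d^2
      + a^1 * b^3 * c^3 * d^1
      + a^1 * b^4 * c^1 * d^2
      + a^1 * b^5 * c^1 * d^1
      + a^2 * b^1 * c^3 * d^2
      + a^2 * b^2 * c^2 * d^2
      + a^2 * b^2 * c^3 * d^1
      + a^2 * b^3 * c^2 * d^1
      + a^2 * b^3 * c^3 * d^0
      + a^2 * b^5 * c^1 * d^0
      + a^3 * b^1 * c^2 * d^2
      + a^3 * b^2 * c^1 * d^2
      + a^3 * b^2 * c^2 * d^1
      + a^3 * b^3 * c^1 * d^1
      + a^3 * b^3 * c^2 * d^0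
      + a^3 * b^4 * c^1 * d^0
      + a^4 * b^1 * c^3 * d^0
      + a^4 * b^3 * c^1 * d^0
      + a^5 * b^1 * c^2 * d^0
      + a^5 * b^2 * c^1 * d^0 := by
  linear_combination (a^1 * b^3 * c^2 * d^2
      + a^1 * b^4 * c^2 * d^1
      + a^2 * b^2 * c^2 * d^2
      + a^2 * b^2 * c^3 * d^1
      + a^2 * b^3 * c^1 * d^2 + 3*a^2 * b^3 * c^2 * d^1 + 2*a^2 * b^4 * c^1 * d^1
      + a^2 * b^4 * c^2 * d^0
      + a^3 * b^1 * c^3 * d^1 + 3*a^3 * b^2 * c^2 * d^1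
      + a^3 * b^2 * c^3 * d^0 + 2*a^3 * b^3 * c^1 * d^1 + 2*a^3 * b^3 * c^2 * d^0
      + a^3 * b^4 * c^1 * d^0
      + a^4 * b^1 * c^2 * d^1
      + a^4 * b^2 * c^1 * d^1 + 2*a^4 * b^2 * c^2 * d^0
      + a^4 * b^3 * c^1 * d^0) * h2

lemma G_expand {R : Type} [CommRing R] (h2 : (2 : R) = 0) (a b c d : R) :
    (d) * (c + d) * (b + d) * (b + c + d) * (a + c) * (a + c + d) =
      a^0 * b^0 * c^1 * d^5
      + a^0 * b^0 * c^2 * d^4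
      + a^0 * b^0 * c^3 * d^3
      + a^0 * b^0 * c^4 * d^2
      + a^0 * b^1 * c^2 * d^3
      + a^0 * b^1 * c^4 * d^1
      + a^0 * b^2 * c^1 * d^3
      + a^0 * b^2 * c^3 * d^1
      + a^1 * b^0 * c^0 * d^5
      + a^1 * b^0 * c^2 * d^3
      + a^1 * b^1 * c^1 * d^3
      + a^1 * b^1 * c^2 * d^2
      + a^1 * b^2 * c^0 * d^3
      + a^1 * b^2 * c^1 * d^2
      + a^2 * b^0 * c^0 * d^4
      + a^2 * b^0 * c^2 * d^2
      + a^2 * b^1 * c^1 * d^2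
      + a^2 * b^1 * c^2 * d^1
      + a^2 * b^2 * c^0 * d^2
      + a^2 * b^2 * c^1 * d^1 := by
  linear_combination (a^0 * b^0 * c^2 * d^4
      + a^0 * b^0 * c^3 * d^3
      + a^0 * b^1 * c^1 * d^4 + 2*a^0 * b^1 * c^2 * d^3 + 2*a^0 * b^1 * c^3 * d^2
      + a^0 * b^2 * c^2 * d^2 + 2*a^1 * b^0 * c^1 * d^4 + 2*a^1 * b^0 * c^2 * d^3
      + a^1 * b^0 * c^3 * d^2
      + a^1 * b^1 * c^0 * d^4 + 3*a^1 * b^1 * c^1 * d^3 + 3*a^1 * b^1 * c^2 * d^2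
      + a^1 * b^1 * c^3 * d^1
      + a^1 * b^2 * c^1 * d^2
      + a^1 * b^2 * c^2 * d^1
      + a^2 * b^0 * c^1 * d^3
      + a^2 * b^1 * c^0 * d^3
      + a^2 * b^1 * c^1 * d^2) * h2


/-- Exponent vectors in four variables. -/
def e4 (a b c d : ℕ) : Fin 4 →₀ ℕ := Finsupp.equivFunOnFinite.symm ![a, b, c, d]

/-- Coefficient extraction. -/
def cf (p : MvPolynomial (Fin 4) (ZMod 2)) (a b c d : ℕ) : ZMod 2 := p.coeff (e4 a b c d)

/-- Monomials in four variables. -/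
def mn (a b c d : ℕ) : MvPolynomial (Fin 4) (ZMod 2) := MvPolynomial.monomial (e4 a b c d) 1

lemma mn_eq (a b c d : ℕ) : (MvPolynomial.X 0 ^ a * MvPolynomial.X 1 ^ b * MvPolynomial.X 2 ^ c *
    MvPolynomial.X 3 ^ d : MvPolynomial (Fin 4) (ZMod 2)) = mn a b c d := by
  unfold mn
  rw [MvPolynomial.monomial_eq, Finsupp.prod_fintype _ _ (by simp), Fin.prod_univ_four]
  simp [e4]

lemma e4_le (a b c d A B C D : ℕ) : e4 a b c d ≤ e4 A B C D ↔ a ≤ A ∧ b ≤ B ∧ c ≤ C ∧ d ≤ D := by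
  constructor
  · intro h
    exact ⟨h 0, h 1, h 2, h 3⟩
  · rintro ⟨h0, h1, h2, h3⟩ i
    fin_cases i <;> assumption

lemma e4_sub (a b c d A B C D : ℕ) : e4 A B C D - e4 a b c d = e4 (A - a) (B - b) (C - c) (D - d) := by
  ext i
  fin_cases i <;> rfl

lemma e4_inj (a b c d A B C D : ℕ) : e4 a b c d = e4 A B C D ↔ a = A ∧ b = B ∧ c = C ∧ d = D := by
  constructor
  · intro h
    exact ⟨DFunLike.congr_fun h 0, DFunLike.congr_fun h 1, DFunLike.congr_fun h 2,
      DFunLike.congr_fun h 3⟩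
  · rintro ⟨rfl, rfl, rfl, rfl⟩; rfl

lemma cf_mn_mul (p : MvPolynomial (Fin 4) (ZMod 2)) (a b c d A B C D : ℕ) :
    cf (mn a b c d * p) A B C D = if a ≤ A ∧ b ≤ B ∧ c ≤ C ∧ d ≤ D then
      cf p (A - a) (B - b) (C - c) (D - d) else 0 := by
  classical
  unfold cf mn
  rw [MvPolynomial.coeff_monomial_mul', one_mul, e4_sub]
  exact if_congr (e4_le ..) rfl rfl

lemma cf_mn (a b c d A B C D : ℕ) :
    cf (mn a b c d) A B C D = if a = A ∧ b = B ∧ c = C ∧ d = D then 1 else 0 := by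
  classical
  unfold cf mn
  rw [MvPolynomial.coeff_monomial]
  exact if_congr (e4_inj ..) rfl rfl

lemma cf_sq (p : MvPolynomial (Fin 4) (ZMod 2)) (A B C D : ℕ) :
    cf (p ^ 2) A B C D = if A % 2 = 0 ∧ B % 2 = 0 ∧ C % 2 = 0 ∧ D % 2 = 0 then
      cf p (A / 2) (B / 2) (C / 2) (D / 2) else 0 := by
  have : Fact (Nat.Prime 2) := ⟨Nat.prime_two⟩
  unfold cf
  rw [← MvPolynomial.expand_zmod]
  split_ifs with h
  · have : e4 A B C D = 2 • e4 (A / 2) (B / 2) (C / 2) (D / 2) := by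
      ext i
      fin_cases i <;> simp [e4] <;> omega
    rw [this, MvPolynomial.coeff_expand_smul 2 (by norm_num)]
  · have : ∃ i, ¬ 2 ∣ e4 A B C D i := by
      by_contra hcon
      push Not at hcon
      apply h
      have h0 : 2 ∣ A := hcon 0
      have h1 : 2 ∣ B := hcon 1
      have h2 : 2 ∣ C := hcon 2
      have h3 : 2 ∣ D := hcon 3
      omega
    obtain ⟨i, hi⟩ := this
    exact MvPolynomial.coeff_expand_of_not_dvd (p := 2) p hi

lemma cf_add (p q : MvPolynomial (Fin 4) (ZMod 2)) (A B C D : ℕ) :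
    cf (p + q) A B C D = cf p A B C D + cf q A B C D := by
  unfold cf; rw [MvPolynomial.coeff_add]

/-- Forms of the first kind. -/
def hvec : Fin 8 → Fin 4 → ZMod 2 := ![![0, 0, 1, 0], ![0, 1, 0, 0], ![0, 1, 1, 0], ![1, 0, 0, 0],
  ![1, 0, 0, 1], ![1, 1, 0, 0], ![1, 1, 0, 1], ![1, 1, 1, 0]]

/-- Forms of the second kind. -/
def gvec : Fin 6 → Fin 4 → ZMod 2 := ![![0, 0, 0, 1], ![0, 0, 1, 1], ![0, 1, 0, 1], ![0, 1, 1, 1],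
  ![1, 0, 1, 0], ![1, 0, 1, 1]]

/-- Product of first kind. -/
def HH : MvPolynomial (Fin 4) (ZMod 2) := ∏ k, lform (hvec k)
/-- Product of second kind. -/
def GG : MvPolynomial (Fin 4) (ZMod 2) := ∏ k, lform (gvec k)

lemma two_eq_zero : (2 : MvPolynomial (Fin 4) (ZMod 2)) = 0 := by
  have h2 : (2 : ZMod 2) = 0 := by decide
  have h : (MvPolynomial.C (2 : ZMod 2) : MvPolynomial (Fin 4) (ZMod 2)) = 2 :=
    map_ofNat MvPolynomial.C 2
  rw [← h, h2, MvPolynomial.C_0]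

lemma cf_odd (p : MvPolynomial (Fin 4) (ZMod 2)) (N a b c d : ℕ)
    (h : a % 2 = 1 ∨ b % 2 = 1 ∨ c % 2 = 1 ∨ d % 2 = 1) :
    cf (mn a b c d * p ^ 2) (2 * N + 2) (2 * N + 2) (2 * N + 2) (2 * N + 2) = 0 := by
  rw [cf_mn_mul]
  split_ifs with hle
  · rw [cf_sq, if_neg]; omega
  · rfl

lemma HH_lf : HH = MvPolynomial.X 2 * MvPolynomial.X 1 * (MvPolynomial.X 1 + MvPolynomial.X 2) *
    MvPolynomial.X 0 * (MvPolynomial.X 0 + MvPolynomial.X 3) *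
    (MvPolynomial.X 0 + MvPolynomial.X 1) *
    (MvPolynomial.X 0 + MvPolynomial.X 1 + MvPolynomial.X 3) *
    (MvPolynomial.X 0 + MvPolynomial.X 1 + MvPolynomial.X 2) := by
  simp [HH, Fin.prod_univ_eight, lform, Fin.sum_univ_four, hvec]

lemma GG_lf : GG = MvPolynomial.X 3 * (MvPolynomial.X 2 + MvPolynomial.X 3) *
    (MvPolynomial.X 1 + MvPolynomial.X 3) *
    (MvPolynomial.X 1 + MvPolynomial.X 2 + MvPolynomial.X 3) *
    (MvPolynomial.X 0 + MvPolynomial.X 2) *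
    (MvPolynomial.X 0 + MvPolynomial.X 2 + MvPolynomial.X 3) := by
  simp [GG, Fin.prod_univ_six, lform, Fin.sum_univ_four, gvec]

lemma cf_H_sq (p : MvPolynomial (Fin 4) (ZMod 2)) (N : ℕ) :
    cf (HH * p ^ 2) (2 * N + 2) (2 * N + 2) (2 * N + 2) (2 * N + 2) = cf p N N N N := by
  rw [HH_lf, H_expand two_eq_zero]
  simp only [mn_eq, add_mul, cf_add]
  simp only [cf_odd, Nat.reduceMod, ne_eq, zero_ne_one, one_ne_zero, OfNat.ofNat_ne_zero,
    OfNat.ofNat_ne_one, not_false_eq_true, or_true, true_or, zero_add, add_zero]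
  rw [cf_mn_mul, if_pos (by omega), cf_sq, if_pos (by omega)]
  congr 1 <;> omega

lemma cf_base : cf (HH * GG ^ 2) 5 5 5 5 = 1 := by
  rw [HH_lf, H_expand two_eq_zero]
  simp only [mn_eq, add_mul, cf_add, cf_mn_mul, cf_sq]
  rw [GG_lf, G_expand two_eq_zero]
  simp only [mn_eq, cf_add, cf_mn]
  decide

lemma cf_main (q m : ℕ) (h1 : 2 ^ q ≤ m) (h2 : m < 2 ^ (q + 1)) :
    cf (HH ^ m * GG ^ (2 ^ (q + 1))) (2 * m + 3 * 2 ^ q) (2 * m + 3 * 2 ^ q) (2 * m + 3 * 2 ^ q)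
      (2 * m + 3 * 2 ^ q) = 1 := by
  induction q generalizing m with
  | zero =>
    have : m = 1 := by simp at h1 h2; omega
    subst this
    simpa using cf_base
  | succ q ih =>
    obtain ⟨k, hk⟩ := Nat.even_or_odd' m
    have hih := ih k (by rw [pow_succ] at h1; omega) (by rw [pow_succ 2 (q + 1)] at h2; omega)
    set P := HH ^ k * GG ^ (2 ^ (q + 1)) with hP
    rcases hk with hk | hk
    · have e : HH ^ m * GG ^ (2 ^ (q + 1 + 1)) = P ^ 2 := by
        rw [hP, hk, pow_succ 2 (q + 1), mul_pow, ← pow_mul, ← pow_mul, mul_comm k 2]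
      rw [e, cf_sq, if_pos (by rw [pow_succ]; omega), ← hih]
      congr 1 <;> (rw [pow_succ]; omega)
    · have e : HH ^ m * GG ^ (2 ^ (q + 1 + 1)) = HH * P ^ 2 := by
        rw [hP, hk, pow_succ 2 (q + 1), mul_pow, ← pow_mul, ← pow_mul, mul_comm k 2]; ring
      have e2 : 2 * m + 3 * 2 ^ (q + 1) = 2 * (2 * k + 3 * 2 ^ q) + 2 := by
        rw [pow_succ]; omega
      rw [e, e2, cf_H_sq, hih]

/-- The final coefficient. -/
lemma coeff_final (d q t n m : ℕ) (ht1 : 1 ≤ t) (ht2 : t ≤ 2 ^ q)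
    (hm : m = 2 ^ (q + 1) - t) (hn : n ≥ d + (7 * 2 ^ q - 2 * t) + 1) :
    ((∏ i : Fin 4, (MvPolynomial.X i) ^ (d + 1)) * ((HH * GG) ^ m * (GG ^ t *
      ∏ i : Fin 4, (MvPolynomial.X i) ^ (n - (d + (7 * 2 ^ q - 2 * t) + 1))))).coeff
      (cexp (Fin 4) n) = 1 := by
  have hp : 2 ^ (q + 1) = 2 * 2 ^ q := by ring
  set k := n - (7 * 2 ^ q - 2 * t) with hk
  have e1 : ((∏ i : Fin 4, (MvPolynomial.X i) ^ (d + 1)) * ((HH * GG) ^ m * (GG ^ t *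
      ∏ i : Fin 4, (MvPolynomial.X i) ^ (n - (d + (7 * 2 ^ q - 2 * t) + 1))))) =
      mn k k k k * (HH ^ m * GG ^ (2 ^ (q + 1))) := by
    have h1 : 2 ^ (q + 1) = m + t := by omega
    have h2 : k = (d + 1) + (n - (d + (7 * 2 ^ q - 2 * t) + 1)) := by omega
    rw [← mn_eq, h1, h2, Fin.prod_univ_four, Fin.prod_univ_four]
    ring
  have e2 : cexp (Fin 4) n = e4 n n n n := by
    ext i; fin_cases i <;> rfl
  have := cf_mn_mul (HH ^ m * GG ^ (2 ^ (q + 1))) k k k k n n n n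
  rw [e1, e2]
  refine this.trans ?_
  rw [if_pos (by omega), ← cf_main q m (by omega) (by omega)]
  congr 1 <;> omega

end poly
end Radon18

namespace Radon18
section cube

/-- Vertices of the four-dimensional cube. -/
abbrev Cube := Fin 4 → ZMod 2

/-- Unit vector. -/
def dl (i : Fin 4) : Cube := Pi.single i 1

lemma cube_add_self (e : Cube) : e + e = 0 := by
  funext i; exact zmod2_add_self _

lemma cube_add_add (e g : Cube) : e + g + g = e := by
  rw [add_assoc, cube_add_self, add_zero]

/-- Real sign character. -/
def chi (a e : Cube) : ℝ := ((sg (∑ i, a i * e i) : ℤ) : ℝ)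

lemma chi_add (a e f : Cube) : chi a (e + f) = chi a e * chi a f := by
  unfold chi
  have : ∑ i, a i * (e + f) i = ∑ i, a i * e i + ∑ i, a i * f i := by
    rw [← Finset.sum_add_distrib]
    exact Finset.sum_congr rfl fun i _ => by rw [Pi.add_apply]; ring
  rw [this, sg_add]; push_cast; rfl

lemma chi_comm (a e : Cube) : chi a e = chi e a := by
  unfold chi; simp only [mul_comm]

lemma chi_zero (e : Cube) : chi 0 e = 1 := by simp [chi, sg]

lemma chi_mul_self (a e : Cube) : chi a e * chi a e = 1 := by
  rw [← chi_add, cube_add_self, chi_comm, chi_zero]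

lemma chi_dl (u : Cube) (i : Fin 4) (h : u i = 1) : chi (dl i) u = -1 := by
  unfold chi dl
  have : ∑ j, (Pi.single i 1 : Cube) j * u j = 1 := by
    rw [Finset.sum_eq_single i]
    · simp [h]
    · intro j _ hj; simp [hj]
    · simp
  rw [this]; simp [sg]

lemma sum_cube_shift (f : Cube → ℝ) (g : Cube) : ∑ e, f (e + g) = ∑ e, f e :=
  Equiv.sum_comp (Equiv.addRight g) f

lemma sum_chi (u : Cube) (hu : u ≠ 0) : ∑ a, chi a u = 0 := by
  obtain ⟨i, hi⟩ := Function.ne_iff.mp hu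
  have hi1 : u i = 1 := by
    have : ∀ z : ZMod 2, z ≠ 0 → z = 1 := by decide
    exact this _ hi
  have h := sum_cube_shift (fun a => chi a u) (dl i)
  have h2 : ∀ a, chi (a + dl i) u = - chi a u := by
    intro a
    rw [chi_comm, chi_add, chi_comm u (dl i), chi_dl u i hi1, chi_comm]; ring
  simp only [h2, Finset.sum_neg_distrib] at h
  linarith

/-- Fourier inversion consequence. -/
lemma fourier_const (h : Cube → ℝ) (hz : ∀ a : Cube, a ≠ 0 → ∑ e, chi a e * h e = 0) (e e' : Cube) :
    h e = h e' := by
  have key : ∀ u, ∑ a, chi a u * ∑ e, chi a e * h e = Fintype.card Cube * h u := by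
    intro u
    simp only [Finset.mul_sum]
    rw [Finset.sum_comm, Finset.sum_eq_single u]
    · have : ∀ a, chi a u * (chi a u * h u) = h u := by
        intro a; rw [← mul_assoc, chi_mul_self, one_mul]
      simp only [this, Finset.sum_const, Finset.card_univ, nsmul_eq_mul]
    · intro v _ hv
      have h1 : ∀ a, chi a u * (chi a v * h v) = chi a (u + v) * h v := by
        intro a; rw [chi_add]; ring
      simp only [h1]
      rw [← Finset.sum_mul, sum_chi, zero_mul]
      intro h0
      apply hv
      have := cube_add_add u v
      rw [h0, zero_add] at this; exact this
    · simp
  have h0 : ∀ u, ∑ a, chi a u * ∑ e, chi a e * h e = ∑ e, h e := by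
    intro u
    rw [Finset.sum_eq_single 0]
    · simp [chi_zero]
    · intro a _ ha; rw [hz a ha, mul_zero]
    · simp
  have hc : (0 : ℝ) < Fintype.card Cube := by
    exact_mod_cast Fintype.card_pos
  have := (key e).symm.trans ((h0 e).trans ((h0 e').symm.trans (key e')))
  exact mul_left_cancel₀ hc.ne' this

lemma weight_four (g : Fin 4 → Cube → ℝ) (hg : ∀ i e, g i (e + dl i) = g i e) :
    ∑ e, chi 1 e * ∑ i, g i e = 0 := by
  simp only [Finset.mul_sum]
  rw [Finset.sum_comm]
  refine Finset.sum_eq_zero fun i _ => ?_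
  have h := sum_cube_shift (fun e => chi 1 e * g i e) (dl i)
  have h2 : ∀ e, chi 1 (e + dl i) * g i (e + dl i) = - (chi 1 e * g i e) := by
    intro e
    rw [hg, chi_add, chi_comm 1 (dl i), chi_dl 1 i rfl]; ring
  simp only [h2, Finset.sum_neg_distrib] at h
  linarith

/-- Even vertices. -/
abbrev Ev := {e : Cube // ∑ i, e i = 0}

lemma card_Ev : Fintype.card Ev = 8 := by decide

lemma sep_aux : ∀ u : Cube, ∑ i, u i = 0 → u ≠ 0 → ∀ i i' : Fin 4, u ≠ dl i + dl i' →
    ∃ k, k ≠ i ∧ k ≠ i' ∧ u k ≠ 0 := by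
  have h : ∀ a b c d : ZMod 2, a + b + c + d = 0 → ∀ i i' : Fin 4, (![a, b, c, d] : Cube) ≠ 0 →
    ![a, b, c, d] ≠ dl i + dl i' → ∃ k, k ≠ i ∧ k ≠ i' ∧ (![a, b, c, d] : Cube) k ≠ 0 := by
    unfold dl
    decide
  intro u hu h0 i i' hne
  have hu' : u = ![u 0, u 1, u 2, u 3] := by
    funext i; fin_cases i <;> rfl
  rw [Fin.sum_univ_four] at hu
  have := h (u 0) (u 1) (u 2) (u 3) hu i i'
  rw [← hu'] at this
  exact this h0 hne

/-- Perfect matching in the support of a fractional perfect matching of the cube. -/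
lemma cube_matching (g : Fin 4 → Cube → ℝ) (hg : ∀ i e, g i (e + dl i) = g i e)
    (hpos : ∀ i e, 0 ≤ g i e) (C : ℝ) (hC : 0 < C) (hs : ∀ e, ∑ i, g i e = C) :
    ∃ ι : Ev → Fin 4, (∀ e, 0 < g (ι e) e.1) ∧
      ∀ e e' : Ev, e ≠ e' → ∃ k, k ≠ ι e ∧ k ≠ ι e' ∧ e.1 k ≠ e'.1 k := by
  classical
  set N : Ev → Finset Cube := fun e =>
    (Finset.univ.filter fun i => 0 < g i e.1).image fun i => e.1 + dl i with hN
  have hall : ∀ s : Finset Ev, s.card ≤ (s.biUnion N).card := by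
    intro s
    have h1 : (s.card : ℝ) * C = ∑ e ∈ s, ∑ i, g i (e.1 + dl i) := by
      rw [← nsmul_eq_mul, ← Finset.sum_const]
      refine Finset.sum_congr rfl fun e _ => ?_
      simp only [hg, hs]
    have h2 : ((s.biUnion N).card : ℝ) * C = ∑ e ∈ s.biUnion N, ∑ i, g i e := by
      rw [← nsmul_eq_mul, ← Finset.sum_const]
      exact Finset.sum_congr rfl fun e _ => (hs e).symm
    have h3 : ∑ e ∈ s, ∑ i, g i (e.1 + dl i) ≤ ∑ e ∈ s.biUnion N, ∑ i, g i e := by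
      rw [Finset.sum_comm, Finset.sum_comm (s := s.biUnion N)]
      refine Finset.sum_le_sum fun i _ => ?_
      rw [← Finset.sum_filter_add_sum_filter_not s (fun e => 0 < g i e.1)]
      have hz : ∑ e ∈ s.filter (fun e => ¬ 0 < g i e.1), g i (e.1 + dl i) = 0 := by
        refine Finset.sum_eq_zero fun e he => ?_
        rw [hg]
        exact le_antisymm (not_lt.mp (Finset.mem_filter.mp he).2) (hpos _ _)
      rw [hz, add_zero]
      have hinj : Set.InjOn (fun e : Ev => e.1 + dl i) (s.filter (fun e => 0 < g i e.1)) := by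
        intro e _ e' _ h
        exact Subtype.ext (add_right_cancel h)
      rw [← Finset.sum_image (f := g i) hinj]
      refine Finset.sum_le_sum_of_subset_of_nonneg ?_ fun e _ _ => hpos i e
      intro v hv
      obtain ⟨e, he, rfl⟩ := Finset.mem_image.mp hv
      rw [Finset.mem_filter] at he
      rw [Finset.mem_biUnion]
      exact ⟨e, he.1, Finset.mem_image.mpr ⟨i, by simp [he.2], rfl⟩⟩
    rw [← h1, ← h2] at h3
    exact_mod_cast le_of_mul_le_mul_right h3 hC
  obtain ⟨f, hf, hfN⟩ := (Finset.all_card_le_biUnion_card_iff_exists_injective N).mp hall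
  have : ∀ e : Ev, ∃ i, 0 < g i e.1 ∧ e.1 + dl i = f e := by
    intro e
    obtain ⟨i, hi, hi'⟩ := Finset.mem_image.mp (hfN e)
    exact ⟨i, (Finset.mem_filter.mp hi).2, hi'⟩
  choose ι hι hιf using this
  refine ⟨ι, hι, fun e e' hne => ?_⟩
  obtain ⟨k, hk, hk', hk0⟩ := sep_aux (e.1 + e'.1) (by
      simp only [Pi.add_apply, Finset.sum_add_distrib, e.2, e'.2, add_zero]) (by
      intro h0
      apply hne
      have := cube_add_add e.1 e'.1
      rw [h0, zero_add] at this
      exact Subtype.ext this.symm) (ι e) (ι e') (by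
      intro h0
      apply hne
      apply hf
      rw [← hιf, ← hιf]
      have h1 := cube_add_add e.1 e'.1
      rw [h0] at h1
      rw [← h1]
      have h2 := cube_add_self (dl (ι e))
      calc dl (ι e) + dl (ι e') + e'.1 + dl (ι e) = (dl (ι e) + dl (ι e)) + e'.1 + dl (ι e') := by abel
        _ = _ := by rw [h2, zero_add])
  refine ⟨k, hk, hk', fun h => hk0 ?_⟩
  rw [Pi.add_apply, h]; exact zmod2_add_self _

end cube
end Radon18

namespace Radon18
section geom
variable {n : ℕ}

/-- Normalised positive part of the `i`-th block. -/
def bp (s : ℝ) (i : Fin 4) (x : Fin 4 × Fin (n + 1) → ℝ) : Fin (n + 1) → ℝ :=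
  fun v => 2 * max (s * x (i, v)) 0 / ∑ w, |x (i, w)|

lemma norm_pos {x : Fin 4 × Fin (n + 1) → ℝ} (hx : x ∈ Sph (Fin 4) n) (i : Fin 4) :
    0 < ∑ w, |x (i, w)| := by
  obtain ⟨q, hq⟩ := hx.2 i
  have := Finset.single_le_sum (f := fun w => |x (i, w)|) (fun w _ => abs_nonneg _)
    (Finset.mem_univ q)
  simp only [hq] at this
  linarith

lemma bp_cont (s : ℝ) (i : Fin 4) : ContinuousOn (bp (n := n) s i) (Sph (Fin 4) n) := by
  refine continuousOn_pi.mpr fun v => ?_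
  refine ContinuousOn.div (by fun_prop) (by fun_prop) ?_
  intro x hx
  exact (norm_pos hx i).ne'

lemma sg_real_cases (e : ZMod 2) : (e = 0 ∧ ((sg e : ℤ) : ℝ) = 1) ∨ (e = 1 ∧ ((sg e : ℤ) : ℝ) = -1) := by
  have h : e = 0 ∨ e = 1 := by revert e; decide
  rcases h with rfl | rfl
  · left; simp [sg]
  · right; simp [sg]

lemma bp_act (s : ℝ) (i : Fin 4) (g : Cube) (x : Fin 4 × Fin (n + 1) → ℝ) :
    bp s i (actR g x) = bp (s * sg (g i)) i x := by
  funext v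
  have h : ∀ w, |actR g x (i, w)| = |x (i, w)| := by
    intro w
    simp only [actR]
    rcases sg_real_cases (g i) with ⟨_, h⟩ | ⟨_, h⟩ <;> simp [h]
  simp only [bp, h]
  simp only [actR, mul_assoc]

lemma bp_mem {x : Fin 4 × Fin (n + 1) → ℝ} (hx : x ∈ Sph (Fin 4) n) (i : Fin 4)
    (h0 : ∑ v, x (i, v) = 0) (s : ℝ) (hs : s = 1 ∨ s = -1) :
    bp s i x ∈ stdSimplex ℝ (Fin (n + 1)) := by
  have hp := norm_pos hx i
  refine ⟨fun v => ?_, ?_⟩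
  · exact div_nonneg (mul_nonneg (by norm_num) (le_max_right _ _)) hp.le
  · simp only [bp]
    rw [← Finset.sum_div, div_eq_one_iff_eq hp.ne']
    have : ∀ v, 2 * max (s * x (i, v)) 0 = |x (i, v)| + s * x (i, v) := by
      intro v
      rcases hs with rfl | rfl
      · rcases le_total 0 (x (i, v)) with h | h
        · rw [abs_of_nonneg h, max_eq_left (by linarith)]; ring
        · rw [abs_of_nonpos h, max_eq_right (by linarith)]; ring
      · rcases le_total 0 (x (i, v)) with h | h
        · rw [abs_of_nonneg h, max_eq_right (by linarith)]; ring
        · rw [abs_of_nonpos h, max_eq_left (by linarith)]; ring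
    simp only [this, Finset.sum_add_distrib, ← Finset.mul_sum, h0, mul_zero, add_zero]

/-- Test functions detecting Radon pairs. -/
def rfun {d : ℕ} (G : Fin d → (Fin (n + 1) → ℝ) → ℝ) (i : Fin 4) (k : Fin (d + 1))
    (x : Fin 4 × Fin (n + 1) → ℝ) : ℝ :=
  Fin.cases (∑ v, x (i, v)) (fun k' => G k' (bp 1 i x) - G k' (bp (-1) i x)) k

lemma rfun_cont {d : ℕ} (G : Fin d → (Fin (n + 1) → ℝ) → ℝ) (hG : ∀ k, Continuous (G k))
    (i : Fin 4) (k : Fin (d + 1)) : ContinuousOn (rfun G i k) (Sph (Fin 4) n) := by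
  refine Fin.cases ?_ (fun k' => ?_) k
  · show ContinuousOn (fun x : Fin 4 × Fin (n + 1) → ℝ => ∑ v, x (i, v)) _
    fun_prop
  · show ContinuousOn (fun x => G k' (bp 1 i x) - G k' (bp (-1) i x)) _
    exact ((hG k').comp_continuousOn (bp_cont 1 i)).sub ((hG k').comp_continuousOn (bp_cont (-1) i))

lemma sum_dl (i : Fin 4) (g : Cube) : ∑ j, dl i j * g j = g i := by
  unfold dl
  rw [Finset.sum_eq_single i]
  · simp
  · intro j _ hj; simp [hj]
  · simp

lemma rfun_act {d : ℕ} (G : Fin d → (Fin (n + 1) → ℝ) → ℝ)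
    (i : Fin 4) (k : Fin (d + 1)) (g : Cube) (x : Fin 4 × Fin (n + 1) → ℝ) :
    rfun G i k (actR g x) = (sg (∑ j, dl i j * g j) : ℝ) * rfun G i k x := by
  rw [sum_dl]
  refine Fin.cases ?_ (fun k' => ?_) k
  · simp only [rfun, Fin.cases_zero, actR, Finset.mul_sum]
  · simp only [rfun, Fin.cases_succ, bp_act]
    rcases sg_real_cases (g i) with ⟨_, h⟩ | ⟨_, h⟩
    · simp [h]
    · simp [h]

/-- Kneser test terms. -/
def tfun (A : Finset (Fin (n + 1))) (i : Fin 4) (e : Cube) (x : Fin 4 × Fin (n + 1) → ℝ) : ℝ :=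
  ∏ v ∈ A, ∏ i' ∈ Finset.univ.erase i, max ((sg (e i') : ℝ) * x (i', v)) 0

lemma tfun_nonneg (A : Finset (Fin (n + 1))) (i : Fin 4) (e : Cube)
    (x : Fin 4 × Fin (n + 1) → ℝ) : 0 ≤ tfun A i e x :=
  Finset.prod_nonneg fun _ _ => Finset.prod_nonneg fun _ _ => le_max_right _ _

lemma tfun_pos (A : Finset (Fin (n + 1))) (i : Fin 4) (e : Cube)
    (x : Fin 4 × Fin (n + 1) → ℝ) (h : ∀ v ∈ A, ∀ i' ≠ i, 0 < (sg (e i') : ℝ) * x (i', v)) :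
    0 < tfun A i e x :=
  Finset.prod_pos fun v hv => Finset.prod_pos fun i' hi' =>
    lt_max_of_lt_left (h v hv i' (Finset.ne_of_mem_erase hi'))

lemma of_tfun_pos {A : Finset (Fin (n + 1))} {i : Fin 4} {e : Cube}
    {x : Fin 4 × Fin (n + 1) → ℝ} (h : 0 < tfun A i e x) :
    ∀ v ∈ A, ∀ i' ≠ i, 0 < (sg (e i') : ℝ) * x (i', v) := by
  intro v hv i' hi'
  by_contra hle
  push Not at hle
  refine h.ne' ?_
  refine Finset.prod_eq_zero hv (Finset.prod_eq_zero (Finset.mem_erase.mpr ⟨hi', Finset.mem_univ _⟩) ?_)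
  exact max_eq_right hle

lemma tfun_cont (A : Finset (Fin (n + 1))) (i : Fin 4) (e : Cube) : Continuous (tfun A i e) := by
  unfold tfun; fun_prop

lemma tfun_act (A : Finset (Fin (n + 1))) (i : Fin 4) (e g : Cube)
    (x : Fin 4 × Fin (n + 1) → ℝ) : tfun A i e (actR g x) = tfun A i (e + g) x := by
  unfold tfun
  refine Finset.prod_congr rfl fun v _ => Finset.prod_congr rfl fun i' _ => ?_
  simp only [actR, Pi.add_apply, sg_add]; push_cast; rw [mul_assoc]

lemma tfun_dl (A : Finset (Fin (n + 1))) (i : Fin 4) (e : Cube)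
    (x : Fin 4 × Fin (n + 1) → ℝ) : tfun A i (e + dl i) x = tfun A i e x := by
  unfold tfun
  refine Finset.prod_congr rfl fun v _ => Finset.prod_congr rfl fun i' hi' => ?_
  have : dl i i' = 0 := by simp [dl, Finset.ne_of_mem_erase hi']
  rw [Pi.add_apply, this, add_zero]

/-- Sum of the Kneser terms over one colour class. -/
def gfun (F : Finset (Finset (Fin (n + 1)))) (i : Fin 4) (e : Cube)
    (x : Fin 4 × Fin (n + 1) → ℝ) : ℝ := ∑ A ∈ F, tfun A i e x

/-- Fourier transform of the Kneser terms. -/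
def kfun (F : Finset (Finset (Fin (n + 1)))) (a : Cube) (x : Fin 4 × Fin (n + 1) → ℝ) : ℝ :=
  ∑ e, chi a e * ∑ i, gfun F i e x

lemma kfun_cont (F : Finset (Finset (Fin (n + 1)))) (a : Cube) : Continuous (kfun F a) := by
  unfold kfun gfun
  have := fun A i e => tfun_cont (n := n) A i e
  fun_prop

lemma kfun_act (F : Finset (Finset (Fin (n + 1)))) (a g : Cube) (x : Fin 4 × Fin (n + 1) → ℝ) :
    kfun F a (actR g x) = (sg (∑ j, a j * g j) : ℝ) * kfun F a x := by
  unfold kfun gfun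
  simp only [tfun_act]
  rw [← sum_cube_shift (fun e => chi a e * ∑ i, ∑ A ∈ F, tfun A i e x) g, Finset.mul_sum]
  refine Finset.sum_congr rfl fun e _ => ?_
  have : chi a g * chi a g = 1 := chi_mul_self a g
  rw [chi_add]
  change _ = chi a g * _
  linear_combination (-(chi a e * ∑ i, ∑ A ∈ F, tfun A i (e + g) x)) * this

lemma vec_cover : ∀ a : Cube, a ≠ 0 → a ≠ 1 → (∃ k, a = hvec k) ∨ ∃ k, a = gvec k := by
  have h : ∀ a b c d : ZMod 2, (![a, b, c, d] : Cube) ≠ 0 → (![a, b, c, d] : Cube) ≠ 1 →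
      (∃ k, (![a, b, c, d] : Cube) = hvec k) ∨ ∃ k, (![a, b, c, d] : Cube) = gvec k := by
    unfold hvec gvec
    decide
  intro a
  have e : a = ![a 0, a 1, a 2, a 3] := by funext i; fin_cases i <;> rfl
  rw [e]; exact h _ _ _ _

lemma kneser_zero (F : Finset (Finset (Fin (n + 1)))) (hne : ∀ A ∈ F, A.Nonempty)
    (hc : ∀ G ⊆ F, G.card = 8 → ¬ (∀ A ∈ G, ∀ B ∈ G, A ≠ B → Disjoint A B))
    (x : Fin 4 × Fin (n + 1) → ℝ)
    (hh : ∀ k, kfun F (hvec k) x = 0) (hg : ∀ k, kfun F (gvec k) x = 0)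
    (A : Finset (Fin (n + 1))) (hA : A ∈ F) (i : Fin 4) (e : Cube) : tfun A i e x = 0 := by
  classical
  have hdl : ∀ i e, gfun F i (e + dl i) x = gfun F i e x := by
    intro i e; simp only [gfun, tfun_dl]
  have hpos : ∀ i e, 0 ≤ gfun F i e x := fun i e => Finset.sum_nonneg fun A _ => tfun_nonneg _ _ _ _
  have hconst := fourier_const (fun e => ∑ i, gfun F i e x) (by
    intro a ha
    by_cases h1 : a = 1
    · subst h1; exact weight_four (fun i e => gfun F i e x) hdl
    · rcases vec_cover a ha h1 with ⟨k, rfl⟩ | ⟨k, rfl⟩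
      · exact hh k
      · exact hg k)
  by_contra hne0
  have htp : 0 < tfun A i e x := lt_of_le_of_ne (tfun_nonneg _ _ _ _) (Ne.symm hne0)
  have hgp : 0 < gfun F i e x := Finset.sum_pos' (fun A _ => tfun_nonneg _ _ _ _) ⟨A, hA, htp⟩
  have hCp : 0 < ∑ i, gfun F i e x := Finset.sum_pos' (fun i _ => hpos i e) ⟨i, Finset.mem_univ _, hgp⟩
  obtain ⟨ι, h1, h2⟩ := cube_matching (fun i e => gfun F i e x) hdl hpos _ hCp
    (fun e' => hconst e' e)
  have h3 : ∀ e : Ev, ∃ B ∈ F, 0 < tfun B (ι e) e.1 x := by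
    intro e
    by_contra hcon
    push Not at hcon
    exact absurd (h1 e) (not_lt.mpr (Finset.sum_nonpos hcon))
  choose B hB hBp using h3
  have hdis : ∀ e e' : Ev, e ≠ e' → Disjoint (B e) (B e') := by
    intro e e' hee
    obtain ⟨k, hk1, hk2, hk3⟩ := h2 e e' hee
    rw [Finset.disjoint_left]
    intro v hv hv'
    have p1 := of_tfun_pos (hBp e) v hv k hk1
    have p2 := of_tfun_pos (hBp e') v hv' k hk2
    rcases sg_real_cases (e.1 k) with ⟨u, h⟩ | ⟨u, h⟩ <;>
    rcases sg_real_cases (e'.1 k) with ⟨u', h'⟩ | ⟨u', h'⟩ <;> rw [h] at p1 <;> rw [h'] at p2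
    · exact hk3 (u.trans u'.symm)
    · linarith
    · linarith
    · exact hk3 (u.trans u'.symm)
  have hinj : Injective B := by
    intro e e' hee
    by_contra hne'
    have := hdis e e' hne'
    rw [← hee, disjoint_self] at this
    exact (hne _ (hB e)).ne_empty this
  refine hc (Finset.univ.image B) ?_ ?_ ?_
  · intro C hC
    obtain ⟨e, _, rfl⟩ := Finset.mem_image.mp hC
    exact hB e
  · rw [Finset.card_image_of_injective _ hinj, Finset.card_univ, card_Ev]
  · intro C hC D hD hCD
    obtain ⟨e, _, rfl⟩ := Finset.mem_image.mp hC
    obtain ⟨e', _, rfl⟩ := Finset.mem_image.mp hD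
    exact hdis e e' fun h => hCD (by rw [h])

lemma lform_dl (i : Fin 4) : lform (dl i) = MvPolynomial.X i := by
  unfold lform dl
  rw [Finset.sum_eq_single i]
  · simp
  · intro j _ hj; simp [hj]
  · simp

lemma exists_zero (d q t n m : ℕ) (ht1 : 1 ≤ t) (ht2 : t ≤ 2 ^ q)
    (hm : m = 2 ^ (q + 1) - t) (hn : n ≥ d + (7 * 2 ^ q - 2 * t) + 1)
    (Fc : Fin m → Finset (Finset (Fin (n + 1))))
    (G : Fin d → (Fin (n + 1) → ℝ) → ℝ) (hG : ∀ k, Continuous (G k)) :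
    ∃ x ∈ Sph (Fin 4) n, (∀ i k, rfun G i k x = 0) ∧ (∀ j k, kfun (Fc j) (hvec k) x = 0) ∧
      ∀ j k, kfun (Fc j) (gvec k) x = 0 := by
  let r := n - (d + (7 * 2 ^ q - 2 * t) + 1)
  let a : (Fin 4 × Fin (d + 1)) ⊕ ((Fin m × (Fin 8 ⊕ Fin 6)) ⊕ ((Fin t × Fin 6) ⊕ (Fin 4 × Fin r))) →
      Cube := Sum.elim (fun p => dl p.1) (Sum.elim (fun p => Sum.elim hvec gvec p.2)
        (Sum.elim (fun p => gvec p.2) (fun p => dl p.1)))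
  let φ : (Fin 4 × Fin (d + 1)) ⊕ ((Fin m × (Fin 8 ⊕ Fin 6)) ⊕ ((Fin t × Fin 6) ⊕ (Fin 4 × Fin r))) →
      (Fin 4 × Fin (n + 1) → ℝ) → ℝ := Sum.elim (fun p => rfun G p.1 p.2)
        (Sum.elim (fun p => kfun (Fc p.1) (Sum.elim hvec gvec p.2)) (fun _ _ => 0))
  obtain ⟨x, hx, h0⟩ := common_zero (n := n) a φ (by
      rintro (⟨i, k⟩ | ⟨j, k⟩ | k)
      · exact rfun_cont G hG i k
      · exact (kfun_cont _ _).continuousOn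
      · exact continuousOn_const) (by
      rintro (⟨i, k⟩ | ⟨j, k⟩ | k) g x hx
      · exact rfun_act G i k g x
      · exact kfun_act _ _ g x
      · exact (mul_zero _).symm) (by
      have h := coeff_final d q t n m ht1 ht2 hm hn
      have e : (∏ k, lform (a k)) = ((∏ i : Fin 4, (MvPolynomial.X i) ^ (d + 1)) * ((HH * GG) ^ m *
          (GG ^ t * ∏ i : Fin 4, (MvPolynomial.X i) ^ r))) := by
        simp only [Fintype.prod_sum_type, Fintype.prod_prod_type, a, Sum.elim_inl, Sum.elim_inr,
          lform_dl, Finset.prod_const, Finset.card_univ, Fintype.card_fin, HH, GG]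
      rw [e, h]; exact one_ne_zero)
  refine ⟨x, hx, fun i k => h0 (Sum.inl (i, k)), fun j k => h0 (Sum.inr (Sum.inl (j, Sum.inl k))),
    fun j k => h0 (Sum.inr (Sum.inl (j, Sum.inr k)))⟩

lemma triple_index : ∀ i₁ i₂ i₃ : Fin 4, i₁ < i₂ → i₂ < i₃ → ∃ i : Fin 4, ∀ i' ≠ i,
    i' = i₁ ∨ i' = i₂ ∨ i' = i₃ := by decide

end geom
end Radon18

open Radon18 in
theorem stmt_18 (d q t n : ℕ) (hd : 1 ≤ d) (ht1 : 1 ≤ t) (ht2 : t ≤ 2 ^ q)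
    (m : ℕ) (hm : m = 2 ^ (q + 1) - t)
    (hn : n ≥ d + (7 * 2 ^ q - 2 * t) + 1)
    (F : Finset (Finset (Fin (n + 1))))
    (hFne : ∀ A ∈ F, A.Nonempty)
    (c : Finset (Fin (n + 1)) → Fin m)
    -- no 8 pairwise disjoint members of F receive the same color
    (hc : ∀ G : Finset (Finset (Fin (n + 1))), G ⊆ F → G.card = 8 →
      (∀ A ∈ G, ∀ B ∈ G, A ≠ B → Disjoint A B) → ¬ ∃ j, ∀ A ∈ G, c A = j)
    (f : (Fin (n + 1) → ℝ) → EuclideanSpace ℝ (Fin d))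
    (hf : ContinuousOn f (stdSimplex ℝ (Fin (n + 1)))) :
    ∃ S T : Fin 4 → Finset (Fin (n + 1)),
      (∀ i, Disjoint (S i) (T i)) ∧
      -- each (S i, T i) is a Radon pair for f
      (∀ i, (f '' simplexFace (S i) ∩ f '' simplexFace (T i)).Nonempty) ∧
      -- no intersection of one set from each of three pairs contains a member of F
      (∀ i₁ i₂ i₃ : Fin 4, i₁ < i₂ → i₂ < i₃ →
        ∀ A₁ ∈ ({S i₁, T i₁} : Set (Finset (Fin (n + 1)))),
        ∀ A₂ ∈ ({S i₂, T i₂} : Set (Finset (Fin (n + 1)))),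
        ∀ A₃ ∈ ({S i₃, T i₃} : Set (Finset (Fin (n + 1)))),
        ∀ B ∈ F, ¬ B ⊆ A₁ ∩ A₂ ∩ A₃) := by
  classical
  -- extend the coordinates of f to the whole space
  have hext : ∀ k : Fin d, ∃ G : (Fin (n + 1) → ℝ) → ℝ, Continuous G ∧
      ∀ y ∈ stdSimplex ℝ (Fin (n + 1)), G y = f y k := by
    intro k
    have hcl : IsClosed (stdSimplex ℝ (Fin (n + 1))) := isClosed_stdSimplex ℝ _
    have hk : ContinuousOn (fun y => f y k) (stdSimplex ℝ (Fin (n + 1))) := by fun_prop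
    obtain ⟨G, hG⟩ := ContinuousMap.exists_restrict_eq hcl
      (⟨fun y => f y k, continuousOn_iff_continuous_domRestrict.mp hk⟩ :
        C(stdSimplex ℝ (Fin (n + 1)), ℝ))
    refine ⟨G, G.continuous, fun y hy => ?_⟩
    exact DFunLike.congr_fun hG ⟨y, hy⟩
  choose G hGc hG using hext
  obtain ⟨x, hx, hr, hh, hg⟩ := exists_zero d q t n m ht1 ht2 hm hn
    (fun j => F.filter fun A => c A = j) G hGc
  have hzero : ∀ B ∈ F, ∀ i e, tfun B i e x = 0 := by
    intro B hB i e
    refine kneser_zero (F.filter fun A => c A = c B) ?_ ?_ x (hh (c B)) (hg (c B)) B ?_ i e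
    · intro A hA; exact hFne A (Finset.mem_filter.mp hA).1
    · intro G' hG' hcard hdis
      exact hc G' (fun A hA => (Finset.mem_filter.mp (hG' hA)).1) hcard hdis
        ⟨c B, fun A hA => (Finset.mem_filter.mp (hG' hA)).2⟩
    · exact Finset.mem_filter.mpr ⟨hB, rfl⟩
  let P : ZMod 2 → Fin 4 → Finset (Fin (n + 1)) := fun e i =>
    Finset.univ.filter fun v => 0 < (sg e : ℝ) * x (i, v)
  have hface : ∀ e i, bp (sg e : ℝ) i x ∈ simplexFace (P e i) := by
    intro e i
    have h0 : ∑ v, x (i, v) = 0 := hr i 0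
    refine ⟨bp_mem hx i h0 _ ?_, ?_⟩
    · rcases sg_real_cases e with ⟨_, h⟩ | ⟨_, h⟩
      · exact Or.inl h
      · exact Or.inr h
    · intro v hv
      have hv' : ¬ 0 < (sg e : ℝ) * x (i, v) := fun h =>
        hv (Finset.mem_filter.mpr ⟨Finset.mem_univ _, h⟩)
      simp only [bp, max_eq_right (not_lt.mp hv'), mul_zero, zero_div]
  have s0 : ((sg 0 : ℤ) : ℝ) = 1 := by simp [sg]
  have s1 : ((sg 1 : ℤ) : ℝ) = -1 := by simp [sg]
  refine ⟨P 0, P 1, ?_, ?_, ?_⟩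
  · intro i
    rw [Finset.disjoint_left]
    intro v h1 h2
    have h1' := (Finset.mem_filter.mp h1).2
    have h2' := (Finset.mem_filter.mp h2).2
    rw [s0] at h1'; rw [s1] at h2'
    linarith
  · intro i
    have f0 := hface 0 i
    have f1 := hface 1 i
    rw [s0] at f0; rw [s1] at f1
    refine ⟨f (bp 1 i x), ⟨_, f0, rfl⟩, ⟨_, f1, ?_⟩⟩
    ext k
    have h : G k (bp 1 i x) - G k (bp (-1) i x) = 0 := hr i k.succ
    rw [hG k _ f0.1, hG k _ f1.1] at h
    linarith
  · intro i₁ i₂ i₃ h12 h23 A₁ hA₁ A₂ hA₂ A₃ hA₃ B hB hsub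
    have hP : ∀ i A, A ∈ ({P 0 i, P 1 i} : Set (Finset (Fin (n + 1)))) → ∃ e, A = P e i := by
      rintro i A (h | h)
      · exact ⟨0, h⟩
      · exact ⟨1, h⟩
    obtain ⟨e₁, rfl⟩ := hP _ _ hA₁
    obtain ⟨e₂, rfl⟩ := hP _ _ hA₂
    obtain ⟨e₃, rfl⟩ := hP _ _ hA₃
    obtain ⟨i, hi⟩ := triple_index i₁ i₂ i₃ h12 h23
    refine (tfun_pos B i (fun i' => if i' = i₁ then e₁ else if i' = i₂ then e₂ else e₃) x
      ?_).ne' (hzero B hB _ _)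
    intro v hv i' hi'
    have hv3 := hsub hv
    rw [Finset.mem_inter, Finset.mem_inter] at hv3
    obtain ⟨⟨v1, v2⟩, v3⟩ := hv3
    have v1' := (Finset.mem_filter.mp v1).2
    have v2' := (Finset.mem_filter.mp v2).2
    have v3' := (Finset.mem_filter.mp v3).2
    rcases hi i' hi' with rfl | rfl | rfl
    · simpa using v1'
    · simpa [h12.ne'] using v2'
    · simpa [h23.ne', (h12.trans h23).ne'] using v3'
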